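/- arXiv:1006.4081 — 2 statements merged into one kernel-verified Lean document; each statement's English description precedes it below -/
import Mathlib

section
/- For every integer k ≥ 3 and every positive integer n, the number of anti-lecture hall compositions of weight n with first entry at most k−2 equals the number of overpartitions of n whose non-overlined parts are not congruent to 0, 1, or −1 modulo k; that is, |F_{k−2}(n)| = |H_k(n)|. -/
/-- `f : ℕ → ℕ` (with `f i` standing for `λ_{i+1}`) is an anti-lecture hall composition:
finitely many nonzero entries and `λ₁/1 ≥ λ₂/2 ≥ λ₃/3 ≥ ⋯ ≥ 0`, i.e.
`(i+1)·λ_i ≥ i·λ_{i+1}` for all `i ≥ 1`. -/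
def IsALH (f : ℕ → ℕ) : Prop :=
  (Function.support f).Finite ∧ ∀ i : ℕ, (i + 1) * f (i + 1) ≤ (i + 2) * f i

/-- The weight `|λ| = λ₁ + λ₂ + ⋯` of a composition. -/
noncomputable def wt (f : ℕ → ℕ) : ℕ := ∑ᶠ i, f i

/-- `F k n`: anti-lecture hall compositions of weight `n` whose first entry is at most `k`. -/
def Fset (k n : ℕ) : Set (ℕ → ℕ) := {f | IsALH f ∧ f 0 ≤ k ∧ wt f = n}

/-- `H k n`: overpartitions of `n` (pairs `(μ, ν)` of multisets of positive integers with `μ`,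
the overlined parts, having distinct parts) such that no non-overlined part (part of `ν`) is
congruent to `0`, `1`, or `-1` modulo `k`. -/
def Hset (k n : ℕ) : Set (Multiset ℕ × Multiset ℕ) :=
  {p | p.1.Nodup ∧ (∀ x ∈ p.1, 0 < x) ∧
    (∀ x ∈ p.2, 0 < x ∧ x % k ≠ 0 ∧ x % k ≠ 1 ∧ x % k ≠ k - 1) ∧
    p.1.sum + p.2.sum = n}

section ALHOverpartitions

open Finset

section QSeries

variable {R : Type*} [CommRing R]

/-- The `q`-Pochhammer symbol `(x; q)_n = ∏_{i < n} (1 - x q ^ i)`. -/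
def qPoch (x q : R) (n : ℕ) : R := ∏ i ∈ range n, (1 - x * q ^ i)

/-- The Gaussian binomial coefficient, defined by a `q`-Pascal recursion. -/
def gaussBinom (q : R) : ℕ → ℕ → R
  | _, 0 => 1
  | 0, _ + 1 => 0
  | n + 1, i + 1 => gaussBinom q n i + q ^ (i + 1) * gaussBinom q n (i + 1)

@[simp] lemma gaussBinom_zero_right (q : R) (n : ℕ) : gaussBinom q n 0 = 1 := by
  cases n <;> rfl

lemma gaussBinom_succ_succ (q : R) (n i : ℕ) :
    gaussBinom q (n + 1) (i + 1) = gaussBinom q n i + q ^ (i + 1) * gaussBinom q n (i + 1) := rfl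

lemma gaussBinom_eq_zero_of_lt (q : R) {n i : ℕ} (h : n < i) : gaussBinom q n i = 0 := by
  induction n generalizing i with
  | zero => obtain ⟨i, rfl⟩ := Nat.exists_eq_succ_of_ne_zero h.ne'; rfl
  | succ n ih =>
    obtain ⟨i, rfl⟩ := Nat.exists_eq_succ_of_ne_zero (Nat.ne_zero_of_lt h)
    rw [Nat.succ_eq_add_one, gaussBinom_succ_succ, ih (by omega), ih (by omega)]; simp

@[simp] lemma gaussBinom_self (q : R) (n : ℕ) : gaussBinom q n n = 1 := by
  induction n with
  | zero => simp
  | succ n ih => rw [gaussBinom_succ_succ, ih, gaussBinom_eq_zero_of_lt q (by omega)]; simp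

lemma gaussBinom_succ_succ' (q : R) (n i : ℕ) :
    gaussBinom q (n + 1) (i + 1) =
      gaussBinom q n (i + 1) + q ^ (n - i) * gaussBinom q n i := by
  induction n generalizing i with
  | zero => cases i <;> simp [gaussBinom]
  | succ n ih =>
    rcases lt_trichotomy i (n + 1) with h | rfl | h
    · rcases i with _ | i
      · have e := gaussBinom_succ_succ q n 0
        rw [ih 0] at e
        rw [gaussBinom_succ_succ, ih 0]
        simp only [gaussBinom_zero_right, Nat.sub_zero, zero_add] at e ⊢
        linear_combination -e
      · have e := gaussBinom_succ_succ q n (i + 1)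
        have e' := gaussBinom_succ_succ q n i
        have h1 : n - i = (n - (i + 1)) + 1 := by omega
        rw [ih (i + 1)] at e
        rw [ih i, h1] at e'
        rw [gaussBinom_succ_succ, ih (i + 1), ih i, show n + 1 - (i + 1) = n - i by omega, h1]
        linear_combination -e - q * q ^ (n - (i + 1)) * e'
    · simp [gaussBinom_eq_zero_of_lt]
    · simp [gaussBinom_eq_zero_of_lt q (show n + 1 < i by omega),
        gaussBinom_eq_zero_of_lt q (show n + 1 < i + 1 by omega),
        gaussBinom_eq_zero_of_lt q (show n + 1 + 1 < i + 1 by omega)]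

lemma sum_gaussBinom_succ (q : R) (n : ℕ) (f : ℕ → R) :
    ∑ i ∈ range (n + 2), gaussBinom q (n + 1) i * f i =
      ∑ i ∈ range (n + 1), gaussBinom q n i * f i +
        ∑ i ∈ range (n + 1), q ^ (n - i) * gaussBinom q n i * f (i + 1) := by
  have h : ∑ i ∈ range (n + 2), gaussBinom q n i * f i =
      ∑ i ∈ range (n + 1), gaussBinom q n i * f i := by
    rw [sum_range_succ, gaussBinom_eq_zero_of_lt q (Nat.lt_succ_self n)]; simp
  rw [← h, sum_range_succ', sum_range_succ' _ (n + 1)]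
  simp only [gaussBinom_succ_succ', gaussBinom_zero_right, add_mul, sum_add_distrib]
  ring

lemma qPoch_succ (x q : R) (n : ℕ) : qPoch x q (n + 1) = qPoch x q n * (1 - x * q ^ n) :=
  prod_range_succ _ _

@[simp] lemma qPoch_zero (x q : R) : qPoch x q 0 = 1 := rfl

lemma qPoch_add (x q : R) (m n : ℕ) :
    qPoch x q (m + n) = qPoch x q m * qPoch (x * q ^ m) q n := by
  simp only [qPoch, prod_range_add, pow_add, mul_assoc]

lemma qPoch_succ' (x q : R) (n : ℕ) : qPoch x q (n + 1) = (1 - x) * qPoch (x * q) q n := by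
  rw [add_comm, qPoch_add]; simp [qPoch]

lemma gaussBinom_mul_qPoch (q : R) (a d : ℕ) :
    gaussBinom q (a + d) a * qPoch q q a * qPoch q q d = qPoch q q (a + d) := by
  induction a generalizing d with
  | zero => simp
  | succ a iha =>
    induction d with
    | zero => simp
    | succ d ihd =>
      have h1 := iha (d + 1)
      rw [show a + 1 + (d + 1) = (a + 1 + d) + 1 by ring, gaussBinom_succ_succ]
      rw [show a + (d + 1) = a + 1 + d by ring] at h1
      rw [qPoch_succ q q (a + 1 + d)]
      calc _ = (gaussBinom q (a + 1 + d) a * qPoch q q a * qPoch q q (d + 1)) * (1 - q * q ^ a)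
            + q ^ (a + 1) * (gaussBinom q (a + 1 + d) (a + 1) * qPoch q q (a + 1) * qPoch q q d)
              * (1 - q * q ^ d) := by rw [qPoch_succ q q a, qPoch_succ q q d]; ring
        _ = _ := by rw [h1, ihd]; ring

/-- The `q`-Chu–Vandermonde sum. -/
lemma sum_qChuVandermonde (q b x : R) (n : ℕ) :
    ∑ i ∈ range (n + 1), gaussBinom q n i *
      (qPoch b q i * qPoch (b * x * q ^ i) q (n - i) * q ^ (i.choose 2) * (-x) ^ i) =
        qPoch x q n := by
  induction n generalizing b with
  | zero => simp
  | succ n ih =>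
    rw [sum_gaussBinom_succ, qPoch_succ]
    have h1 : ∀ i ∈ range (n + 1), gaussBinom q n i * (qPoch b q i *
        qPoch (b * x * q ^ i) q (n + 1 - i) * q ^ (i.choose 2) * (-x) ^ i) =
        (gaussBinom q n i * (qPoch b q i *
          qPoch (b * x * q ^ i) q (n - i) * q ^ (i.choose 2) * (-x) ^ i)) *
            (1 - b * x * q ^ n) := by
      intro i hi
      rw [mem_range] at hi
      rw [show n + 1 - i = n - i + 1 by omega, qPoch_succ, mul_assoc (b * x), ← pow_add,
        show i + (n - i) = n by omega]
      ring
    have h2 : ∀ i ∈ range (n + 1), q ^ (n - i) * gaussBinom q n i * (qPoch b q (i + 1) *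
        qPoch (b * x * q ^ (i + 1)) q (n + 1 - (i + 1)) * q ^ ((i + 1).choose 2) *
          (-x) ^ (i + 1)) =
        (gaussBinom q n i * (qPoch (b * q) q i *
          qPoch (b * q * x * q ^ i) q (n - i) * q ^ (i.choose 2) * (-x) ^ i)) *
            (-x * q ^ n * (1 - b)) := by
      intro i hi
      rw [mem_range] at hi
      rw [show n + 1 - (i + 1) = n - i by omega, qPoch_succ',
        show b * x * q ^ (i + 1) = b * q * x * q ^ i by ring,
        show (i + 1).choose 2 = i + i.choose 2 by rw [Nat.choose_succ_succ' i 1]; simp,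
        show q ^ n = q ^ (n - i) * q ^ i by rw [← pow_add]; congr 1; omega]
      ring
    rw [sum_congr rfl h1, sum_congr rfl h2, ← sum_mul, ← sum_mul, ih, ih]
    ring

/-- The finite `q`-binomial theorem, in homogeneous form. -/
lemma prod_sub_mul_pow (q u v : R) (n : ℕ) :
    ∏ i ∈ range n, (u - v * q ^ i) =
      ∑ i ∈ range (n + 1), gaussBinom q n i * (q ^ (i.choose 2) * (-v) ^ i * u ^ (n - i)) := by
  induction n generalizing v with
  | zero => simp
  | succ n ih =>
    rw [sum_gaussBinom_succ, prod_range_succ, mul_sub, ih, sum_mul, sum_mul, sub_eq_add_neg,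
      ← sum_neg_distrib]
    congr 1
    · refine sum_congr rfl fun i hi => ?_
      rw [mem_range] at hi
      rw [show n + 1 - i = n - i + 1 by omega]
      ring
    · refine sum_congr rfl fun i hi => ?_
      rw [mem_range] at hi
      rw [show n + 1 - (i + 1) = n - i by omega,
        show (i + 1).choose 2 = i + i.choose 2 by rw [Nat.choose_succ_succ' i 1]; simp,
        show q ^ n = q ^ (n - i) * q ^ i by rw [← pow_add]; congr 1; omega]
      ring

end QSeries

lemma choose_two_add (a b : ℕ) :
    (a + b).choose 2 = a.choose 2 + b.choose 2 + a * b := by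
  induction b with
  | zero => simp
  | succ b ih =>
    rw [← add_assoc, Nat.choose_succ_succ' (a + b) 1, Nat.choose_succ_succ' b 1, ih]
    simp only [Nat.choose_one_right]
    ring

section Bailey

variable {K : Type*} [Field K] {q : K}

lemma sum_bailey_kernel (hq : ∀ n, qPoch q q n ≠ 0) (r N : ℕ) :
    ∑ i ∈ range (N + 1), gaussBinom q (r + N) (r + i) * q ^ (r + i + 1).choose 2 *
      (qPoch q q (r + i) * qPoch (-q) q (r + i) / (qPoch q q i * qPoch q q (2 * r + 1 + i))) =
    q ^ (r + 1).choose 2 * (qPoch q q (r + N) * qPoch (-q) q (r + N) /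
      (qPoch q q N * qPoch q q (2 * r + 1 + N))) := by
  have key := sum_qChuVandermonde q (-q ^ (r + 1)) (-q ^ (r + 1)) N
  have hneg : ∀ s, qPoch (-q) q (r + s) = qPoch (-q) q r * qPoch (-q ^ (r + 1)) q s := by
    intro s; rw [qPoch_add]; congr 2; ring
  rw [hneg N, ← key, mul_sum, mul_sum, sum_div, mul_sum]
  refine sum_congr rfl fun i hi => ?_
  rw [mem_range] at hi
  obtain ⟨d, rfl⟩ : ∃ d, N = i + d := ⟨N - i, by omega⟩
  have h1 := gaussBinom_mul_qPoch q (r + i) d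
  have h2 := gaussBinom_mul_qPoch q i d
  have h3 := qPoch_add q q (2 * r + 1 + i) d
  rw [show q * q ^ (2 * r + 1 + i) = -q ^ (r + 1) * -q ^ (r + 1) * q ^ i by ring] at h3
  rw [hneg i, show i + d - i = d by omega,
    show r + i + 1 = (r + 1) + i by ring, choose_two_add (r + 1) i, neg_neg, ← pow_mul]
  rw [← add_assoc r i d, ← add_assoc (2 * r + 1) i d, ← h1, ← h2, h3]
  have a1 := hq (r + i)
  have a2 := hq i
  have a3 := hq d
  have a4 := hq (2 * r + 1 + i)
  have a5 : gaussBinom q (i + d) i ≠ 0 := by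
    intro h; apply hq (i + d); rw [← h2, h]; simp
  have a6 : qPoch (-q ^ (r + 1) * -q ^ (r + 1) * q ^ i) q d ≠ 0 := by
    intro h; apply hq (2 * r + 1 + i + d); rw [h3, h]; simp
  generalize qPoch (-q ^ (r + 1) * -q ^ (r + 1) * q ^ i) q d = W at a6 ⊢
  field_simp
  ring

lemma sum_range_sum_range_succ (n : ℕ) (f : ℕ → ℕ → K) :
    ∑ j ∈ range (n + 1), ∑ r ∈ range (j + 1), f j r =
      ∑ r ∈ range (n + 1), ∑ i ∈ range (n - r + 1), f (r + i) r := by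
  rw [sum_sigma', sum_sigma']
  refine sum_nbij' (fun p => ⟨p.2, p.1 - p.2⟩) (fun p => ⟨p.1 + p.2, p.1⟩) ?_ ?_ ?_ ?_ ?_
  · rintro ⟨a, b⟩; simp; omega
  · rintro ⟨a, b⟩; simp; omega
  · rintro ⟨a, b⟩; simp; omega
  · rintro ⟨a, b⟩; simp
  · rintro ⟨a, b⟩ h
    simp at h
    simp [show b + (a - b) = a by omega]

/-- The `m`-th element of the Bailey chain started at the unit Bailey pair relative to `q`,
normalised by `(q; q)_n (-q; q)_n`. -/
noncomputable def baileyChain (q : K) (m n : ℕ) : K :=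
  qPoch q q n * qPoch (-q) q n * ∑ r ∈ range (n + 1),
    (-1) ^ r * q ^ (r.choose 2 + m * (r + 1).choose 2) * (1 - q ^ (2 * r + 1)) /
      (qPoch q q (n - r) * qPoch q q (n + r + 1))

lemma sum_baileyChain (hq : ∀ n, qPoch q q n ≠ 0) (m n : ℕ) :
    ∑ j ∈ range (n + 1), gaussBinom q n j * q ^ (j + 1).choose 2 * baileyChain q m j =
      baileyChain q (m + 1) n := by
  simp only [baileyChain, mul_sum]
  rw [sum_range_sum_range_succ]
  refine sum_congr rfl fun r hr => ?_
  rw [mem_range] at hr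
  obtain ⟨N, rfl⟩ : ∃ N, n = r + N := ⟨n - r, by omega⟩
  have key := sum_bailey_kernel hq r N
  rw [show r + N - r = N by omega]
  calc _ = ((-1) ^ r * q ^ (r.choose 2 + m * (r + 1).choose 2) * (1 - q ^ (2 * r + 1))) *
        ∑ i ∈ range (N + 1), gaussBinom q (r + N) (r + i) * q ^ (r + i + 1).choose 2 *
      (qPoch q q (r + i) * qPoch (-q) q (r + i) /
        (qPoch q q i * qPoch q q (2 * r + 1 + i))) := by
        rw [mul_sum]
        refine sum_congr rfl fun i _ => ?_
        rw [show r + i - r = i by omega, show r + i + r + 1 = 2 * r + 1 + i by ring]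
        ring
    _ = _ := by
        rw [key, show r + N + r + 1 = 2 * r + 1 + N by ring]
        ring

lemma sum_unit_bailey_pair (hq : ∀ n, qPoch q q n ≠ 0) (n R : ℕ) (hR : R ≤ n + 1) :
    (1 - q ^ n) * ∑ r ∈ range R, (-1) ^ r * q ^ (r.choose 2) * (1 - q ^ (2 * r + 1)) /
      (qPoch q q (n - r) * qPoch q q (n + r + 1)) =
    -(-1) ^ R * q ^ (R.choose 2) * (1 - q ^ R) * (1 - q ^ (n + 1 - R)) /
      (qPoch q q (n + 1 - R) * qPoch q q (n + R)) := by
  induction R with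
  | zero => simp
  | succ R ih =>
    obtain ⟨d, rfl⟩ : ∃ d, n = R + d := ⟨n - R, by omega⟩
    rw [sum_range_succ, mul_add, ih (by omega)]
    rw [show R + d + 1 - R = d + 1 by omega, show R + d + 1 - (R + 1) = d by omega,
      show R + d - R = d by omega, show R + d + (R + 1) = R + d + R + 1 by ring]
    have e : (R + 1).choose 2 = R + R.choose 2 := by rw [Nat.choose_succ_succ' R 1]; simp
    have a1 := hq (d + 1)
    have a2 := hq (R + d + R + 1)
    rw [qPoch_succ] at a1 a2
    rw [qPoch_succ q q d, qPoch_succ q q (R + d + R), e]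
    have b1 := left_ne_zero_of_mul a1
    have b2 := right_ne_zero_of_mul a1
    have b3 := left_ne_zero_of_mul a2
    have b4 := right_ne_zero_of_mul a2
    field_simp
    ring

lemma baileyChain_zero (hq : ∀ n, qPoch q q n ≠ 0) (n : ℕ) :
    baileyChain q 0 n = if n = 0 then 1 else 0 := by
  split_ifs with h
  · subst h
    have := hq 1
    simp [baileyChain, qPoch] at *
    exact this
  · have key := sum_unit_bailey_pair hq n (n + 1) le_rfl
    simp only [Nat.sub_self, pow_zero, sub_self, mul_zero, zero_div] at key
    have hn : 1 - q ^ n ≠ 0 := by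
      obtain ⟨n, rfl⟩ := Nat.exists_eq_succ_of_ne_zero h
      have := hq (n + 1)
      rw [qPoch_succ] at this
      convert right_ne_zero_of_mul this using 2
      rw [pow_succ']
    simp only [baileyChain, zero_mul, add_zero]
    rw [(mul_eq_zero.mp key).resolve_left hn, mul_zero]

end Bailey

section ALHPoly

variable {R : Type*} [CommRing R]

/-- The generating function, evaluated at `q`, of anti-lecture hall compositions with at most `n`
parts and first part at most `m`. -/
def alhPoly (q : R) : ℕ → ℕ → R
  | 0, _ => 1
  | m + 1, n => ∑ j ∈ range (n + 1), gaussBinom q n j * q ^ (j + 1).choose 2 * alhPoly q m j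

lemma alhPoly_eq_baileyChain {K : Type*} [Field K] {q : K} (hq : ∀ n, qPoch q q n ≠ 0)
    (m n : ℕ) : alhPoly q m n = baileyChain q (m + 1) n := by
  induction m generalizing n with
  | zero =>
    rw [← sum_baileyChain hq, sum_range_succ']
    simp [baileyChain_zero hq, alhPoly]
  | succ m ih => rw [← sum_baileyChain hq, alhPoly]; simp only [ih]

lemma map_qPoch {S : Type*} [CommRing S] (f : R →+* S) (x q : R) (n : ℕ) :
    f (qPoch x q n) = qPoch (f x) (f q) n := by
  simp [qPoch]

lemma map_gaussBinom {S : Type*} [CommRing S] (f : R →+* S) (q : R) (n i : ℕ) :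
    f (gaussBinom q n i) = gaussBinom (f q) n i := by
  induction n generalizing i with
  | zero => cases i <;> simp [gaussBinom]
  | succ n ih => cases i <;> simp [gaussBinom, ih]

lemma map_alhPoly {S : Type*} [CommRing S] (f : R →+* S) (q : R) (m n : ℕ) :
    f (alhPoly q m n) = alhPoly (f q) m n := by
  induction m generalizing n with
  | zero => simp [alhPoly]
  | succ m ih => simp [alhPoly, ih, map_gaussBinom]

lemma alhPoly_mul_qPoch_X (m n : ℕ) :
    alhPoly (Polynomial.X : Polynomial ℤ) m n * qPoch Polynomial.X Polynomial.X (2 * n + 1) =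
      qPoch Polynomial.X Polynomial.X n * qPoch (-Polynomial.X) Polynomial.X n *
        ∑ r ∈ range (n + 1), (-1) ^ r *
          Polynomial.X ^ (r.choose 2 + (m + 1) * (r + 1).choose 2) *
            (1 - Polynomial.X ^ (2 * r + 1)) *
              gaussBinom Polynomial.X (2 * n + 1) (n - r) := by
  let f := algebraMap (Polynomial ℤ) (FractionRing (Polynomial ℤ))
  have hf : Function.Injective f := IsFractionRing.injective _ _
  have hX : ∀ n, qPoch (Polynomial.X : Polynomial ℤ) Polynomial.X n ≠ 0 := by
    intro n
    refine prod_ne_zero_iff.mpr fun i _ h => ?_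
    have := congrArg (Polynomial.coeff · 0) h
    simp [← pow_succ'] at this
  have hq : ∀ n, qPoch (f Polynomial.X) (f Polynomial.X) n ≠ 0 := by
    intro n
    rw [← map_qPoch]
    exact (map_ne_zero_iff f hf).mpr (hX n)
  apply hf
  simp only [map_mul, map_sum, map_alhPoly, map_qPoch, map_gaussBinom, map_pow, map_sub, map_neg,
    map_one]
  rw [alhPoly_eq_baileyChain hq, baileyChain, mul_assoc, sum_mul]
  congr 1
  refine sum_congr rfl fun r hr => ?_
  rw [mem_range] at hr
  obtain ⟨d, rfl⟩ : ∃ d, n = r + d := ⟨n - r, by omega⟩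
  have h := gaussBinom_mul_qPoch (f Polynomial.X) d (r + d + r + 1)
  rw [show r + d - r = d by omega, show 2 * (r + d) + 1 = d + (r + d + r + 1) by ring, ← h]
  have a1 := hq d
  have a2 := hq (r + d + r + 1)
  field_simp

lemma alhPoly_mul_qPoch (q : R) (m n : ℕ) :
    alhPoly q m n * qPoch q q (2 * n + 1) =
      qPoch q q n * qPoch (-q) q n *
        ∑ r ∈ range (n + 1), (-1) ^ r * q ^ (r.choose 2 + (m + 1) * (r + 1).choose 2) *
            (1 - q ^ (2 * r + 1)) * gaussBinom q (2 * n + 1) (n - r) := by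
  have h := congrArg (Polynomial.eval₂RingHom (Int.castRingHom R) q) (alhPoly_mul_qPoch_X m n)
  simpa only [map_mul, map_sum, map_alhPoly, map_qPoch, map_gaussBinom, map_pow, map_sub,
    map_neg, map_one, Polynomial.coe_eval₂RingHom, Polynomial.eval₂_X] using h

end ALHPoly

section TripleProduct

variable {R : Type*} [CommRing R]

lemma gaussBinom_symm (q : R) (a d : ℕ) : gaussBinom q (a + d) a = gaussBinom q (a + d) d := by
  induction a generalizing d with
  | zero => simp
  | succ a iha =>
    induction d with
    | zero => simp
    | succ d ihd =>
      have h := iha (d + 1)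
      rw [show a + (d + 1) = a + 1 + d by ring] at h
      rw [show a + 1 + (d + 1) = (a + 1 + d) + 1 by ring, gaussBinom_succ_succ, h, ihd,
        gaussBinom_succ_succ', show a + 1 + d - d = a + 1 by omega]

lemma prod_pow_range_eq (q : R) (n : ℕ) : ∏ i ∈ range n, q ^ i = q ^ n.choose 2 := by
  rw [prod_pow_eq_pow_sum, sum_range_id, Nat.choose_two_right]

/-- The finite Jacobi triple product identity. -/
lemma qPoch_mul_qPoch [IsDomain R] {y z : R} (hy : y ≠ 0) (hz : z ≠ 0) (n : ℕ) :
    qPoch z (y * z) n * qPoch y (y * z) n = gaussBinom (y * z) (2 * n) n +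
      ∑ r ∈ range n, (-1) ^ (r + 1) * (y * z) ^ (r + 1).choose 2 * (z ^ (r + 1) + y ^ (r + 1)) *
        gaussBinom (y * z) (2 * n) (n - (r + 1)) := by
  have key := prod_sub_mul_pow (y * z) ((y * z) ^ n) z (n + n)
  have hQ : y * z ≠ 0 := mul_ne_zero hy hz
  have hW : (-z) ^ n * (y * z) ^ (n.choose 2 + n * n) ≠ 0 :=
    mul_ne_zero (pow_ne_zero _ (neg_ne_zero.mpr hz)) (pow_ne_zero _ hQ)
  have hL1 : ∏ i ∈ range n, ((y * z) ^ n - z * (y * z) ^ i) =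
      (-z) ^ n * (y * z) ^ n.choose 2 * qPoch y (y * z) n := by
    rw [qPoch, ← prod_range_reflect (fun i => 1 - y * (y * z) ^ i), ← prod_pow_range_eq, pow_eq_prod_const (-z) n,
      ← prod_mul_distrib, ← prod_mul_distrib]
    refine prod_congr rfl fun i hi => ?_
    rw [mem_range] at hi
    obtain ⟨d, rfl⟩ : ∃ d, n = i + d + 1 := ⟨n - i - 1, by omega⟩
    rw [show i + d + 1 - 1 - i = d by omega]
    ring
  have hL2 : ∏ i ∈ range n, ((y * z) ^ n - z * (y * z) ^ (n + i)) =
      (y * z) ^ (n * n) * qPoch z (y * z) n := by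
    rw [qPoch, pow_mul, pow_eq_prod_const ((y * z) ^ n) n, ← prod_mul_distrib]
    refine prod_congr rfl fun i _ => ?_
    ring
  rw [prod_range_add, hL1, hL2, show n + n + 1 = n + (n + 1) by ring, sum_range_add,
    sum_range_succ', ← sum_range_reflect] at key
  apply mul_left_cancel₀ hW
  calc _ = (-z) ^ n * (y * z) ^ n.choose 2 * qPoch y (y * z) n *
        ((y * z) ^ (n * n) * qPoch z (y * z) n) := by ring
    _ = _ := by
      rw [key, mul_add, ← add_assoc, ← sum_add_distrib, mul_sum, add_comm]
      congr 1
      · rw [← two_mul, show 2 * n - (n + 0) = n by omega, add_zero]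
        ring
      · refine sum_congr rfl fun r hr => ?_
        rw [mem_range] at hr
        obtain ⟨d, rfl⟩ : ∃ d, n = d + (r + 1) := ⟨n - (r + 1), by omega⟩
        have h := gaussBinom_symm (y * z) (d + (r + 1) + (r + 1)) d
        rw [show d + (r + 1) + (r + 1) + d = d + (r + 1) + (d + (r + 1)) by ring] at h
        rw [show d + (r + 1) - 1 - r = d by omega, h, show d + (r + 1) - (r + 1) = d by omega,
          show d + (r + 1) + (d + (r + 1)) - d = d + (r + 1) + (r + 1) by omega,
          show d + (r + 1) + (d + (r + 1)) - (d + (r + 1) + (r + 1)) = d by omega,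
          two_mul, choose_two_add (d + (r + 1)) (r + 1), choose_two_add d (r + 1)]
        rw [neg_pow z d, neg_pow z (d + (r + 1)), neg_pow z (d + (r + 1) + (r + 1))]
        have hs : ((-1 : R) ^ (r + 1)) * (-1) ^ (r + 1) = 1 := by
          rw [← mul_pow]; simp
        have hc : (r + 1) * (r + 1) = 2 * (r + 1).choose 2 + (r + 1) := by
          rw [Nat.choose_two_right, Nat.mul_div_cancel' (Nat.even_mul_pred_self _).two_dvd]
          simp; ring
        generalize r + 1 = s at hs hc ⊢
        have hpow : ((y * z) ^ (d + s)) ^ (d + s + s) = (y * z) ^ ((d + s) * (d + s)) *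
            (y * z) ^ (d * s) * ((y * z) ^ s.choose 2) ^ 2 * (y ^ s * z ^ s) := by
          rw [← mul_pow, ← pow_mul, ← pow_mul, ← pow_add, ← pow_add, ← pow_add]
          congr 1
          linear_combination hc
        rw [hpow]
        generalize gaussBinom (y * z) (d + s + (d + s)) d = G
        linear_combination (-(G * (y * z) ^ d.choose 2 * (-1) ^ d * z ^ d *
          ((y * z) ^ ((d + s) * (d + s)) * (y * z) ^ (d * s) * ((y * z) ^ s.choose 2) ^ 2 *
            (y ^ s * z ^ s)))) * hs

end TripleProduct

section Truncated

variable {R : Type*} [CommRing R] {x : R} {w : ℕ}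

lemma qPoch_eq_of_le {x q : R} (hx : ∀ i, w ≤ i → x * q ^ i = 0) {n : ℕ} (hn : w ≤ n) :
    qPoch x q n = qPoch x q w := by
  obtain ⟨d, rfl⟩ := Nat.exists_eq_add_of_le hn
  have h : ∏ i ∈ range d, (1 - x * q ^ (w + i)) = 1 :=
    prod_eq_one fun i _ => by rw [hx _ (by omega), sub_zero]
  rw [qPoch, prod_range_add, h, mul_one, qPoch]

lemma qPoch_self_eq_of_le (hx : x ^ (w + 1) = 0) {n : ℕ} (hn : w ≤ n) :
    qPoch x x n = qPoch x x w :=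
  qPoch_eq_of_le (fun i hi => by rw [← pow_succ']; exact pow_eq_zero_of_le (by omega) hx) hn

lemma isUnit_qPoch_self (hx : x ^ (w + 1) = 0) (n : ℕ) : IsUnit (qPoch x x n) := by
  rw [qPoch]
  refine Finset.prod_induction _ IsUnit (fun _ _ => IsUnit.mul) isUnit_one fun i _ => ?_
  refine IsNilpotent.isUnit_one_sub ⟨w + 1, ?_⟩
  rw [mul_pow, hx, zero_mul]

lemma gaussBinom_mul_qPoch_of_le (hx : x ^ (w + 1) = 0) {a d : ℕ} (ha : w ≤ a) (hd : w ≤ d) :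
    gaussBinom x (a + d) a * qPoch x x w = 1 := by
  have h := gaussBinom_mul_qPoch x a d
  rw [qPoch_self_eq_of_le hx ha, qPoch_self_eq_of_le hx hd,
    qPoch_self_eq_of_le hx (by omega : w ≤ a + d)] at h
  exact (isUnit_qPoch_self hx w).mul_right_cancel (h.trans (one_mul _).symm)

lemma alhPoly_mul_qPoch_of_pow_eq_zero (hx : x ^ (w + 1) = 0) (m : ℕ) :
    alhPoly x m (2 * w) * qPoch x x w = qPoch (-x) x (2 * w) *
      ∑ r ∈ range (2 * w + 1), (-1) ^ r * x ^ (r.choose 2 + (m + 1) * (r + 1).choose 2) *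
        (1 - x ^ (2 * r + 1)) := by
  have h := alhPoly_mul_qPoch x m (2 * w)
  rw [qPoch_self_eq_of_le hx (by omega : w ≤ 2 * (2 * w) + 1),
    qPoch_self_eq_of_le hx (by omega : w ≤ 2 * w)] at h
  rw [h, mul_comm (qPoch x x w), mul_assoc, mul_sum]
  congr 1
  refine sum_congr rfl fun r hr => ?_
  rw [mem_range] at hr
  by_cases hrw : r ≤ w
  · have hg := gaussBinom_mul_qPoch_of_le hx (show w ≤ 2 * w - r by omega)
      (show w ≤ 2 * w + r + 1 by omega)
    rw [show 2 * w - r + (2 * w + r + 1) = 2 * (2 * w) + 1 by omega] at hg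
    linear_combination ((-1) ^ r * x ^ (r.choose 2 + (m + 1) * (r + 1).choose 2) *
        (1 - x ^ (2 * r + 1))) * hg
  · have h1 : r ≤ (r + 1).choose 2 := by
      rw [Nat.choose_succ_succ' r 1]; simp
    have h2 : (r + 1).choose 2 ≤ (m + 1) * (r + 1).choose 2 := Nat.le_mul_of_pos_left _ (by omega)
    rw [pow_eq_zero_of_le (by omega) hx]
    ring

lemma triple_product_of_pow_eq_zero (hx : x ^ (w + 1) = 0) (l : ℕ) {n : ℕ} (hn : 2 * w ≤ n) :
    qPoch x (x ^ (l + 3)) n * qPoch (x ^ (l + 2)) (x ^ (l + 3)) n *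
      qPoch (x ^ (l + 3)) (x ^ (l + 3)) n =
    ∑ r ∈ range (n + 1), (-1) ^ r * x ^ (r.choose 2 + (l + 2) * (r + 1).choose 2) *
        (1 - x ^ (2 * r + 1)) := by
  have hJ := qPoch_mul_qPoch (pow_ne_zero (l + 2) (Polynomial.X_ne_zero (R := ℤ)))
    (Polynomial.X_ne_zero (R := ℤ)) n
  have h := congrArg (Polynomial.eval₂RingHom (Int.castRingHom R) x) hJ
  simp only [map_mul, map_sum, map_qPoch, map_gaussBinom, map_pow, map_add,
    map_neg, map_one, Polynomial.coe_eval₂RingHom, Polynomial.eval₂_X, ← pow_succ] at h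
  have hQ : (x ^ (l + 3)) ^ (w + 1) = 0 := by rw [← pow_mul', pow_mul, hx, zero_pow (by omega)]
  have hg : gaussBinom (x ^ (l + 3)) (2 * n) n * qPoch (x ^ (l + 3)) (x ^ (l + 3)) n = 1 := by
    rw [two_mul, qPoch_self_eq_of_le hQ (by omega : w ≤ n)]
    exact gaussBinom_mul_qPoch_of_le hQ (by omega) (by omega)
  rw [show l + 2 + 1 = l + 3 by ring] at h
  rw [h, add_mul, hg, sum_mul]
  have hterm : ∀ r ∈ range n, (-1) ^ (r + 1) * (x ^ (l + 3)) ^ (r + 1).choose 2 *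
      (x ^ (r + 1) + (x ^ (l + 2)) ^ (r + 1)) *
        gaussBinom (x ^ (l + 3)) (2 * n) (n - (r + 1)) * qPoch (x ^ (l + 3)) (x ^ (l + 3)) n =
      (-1) ^ (r + 1) * (x ^ (l + 3)) ^ (r + 1).choose 2 * (x ^ (l + 2)) ^ (r + 1) +
        (-1) ^ (r + 1) * (x ^ (l + 3)) ^ (r + 1).choose 2 * x ^ (r + 1) := by
    intro r hr
    rw [mem_range] at hr
    by_cases hrw : r + 1 ≤ w
    · have hg := gaussBinom_mul_qPoch_of_le hQ (show w ≤ n - (r + 1) by omega)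
        (show w ≤ n + (r + 1) by omega)
      rw [show n - (r + 1) + (n + (r + 1)) = 2 * n by omega] at hg
      rw [qPoch_self_eq_of_le hQ (by omega : w ≤ n)]
      linear_combination ((-1) ^ (r + 1) * (x ^ (l + 3)) ^ (r + 1).choose 2 *
        (x ^ (r + 1) + (x ^ (l + 2)) ^ (r + 1))) * hg
    · rw [← pow_mul x (l + 2), pow_eq_zero_of_le (show w + 1 ≤ r + 1 by omega) hx,
        pow_eq_zero_of_le (show w + 1 ≤ (l + 2) * (r + 1) by nlinarith) hx]
      ring
  have hsplit : ∀ r, (-1) ^ r * x ^ (r.choose 2 + (l + 2) * (r + 1).choose 2) *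
      (1 - x ^ (2 * r + 1)) = (-1) ^ r * (x ^ (l + 3)) ^ r.choose 2 * (x ^ (l + 2)) ^ r +
        (-1) ^ (r + 1) * (x ^ (l + 3)) ^ (r + 1).choose 2 * x ^ (r + 1) := by
    intro r
    rw [show (r + 1).choose 2 = r + r.choose 2 by rw [Nat.choose_succ_succ' r 1]; simp]
    ring
  rw [sum_congr rfl hterm, sum_congr rfl fun r _ => hsplit r, sum_add_distrib, sum_add_distrib,
    sum_range_succ', sum_range_succ _ n, pow_eq_zero_of_le (show w + 1 ≤ n + 1 by omega) hx]
  simp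
  ring

lemma prod_range_mul_eq (f : ℕ → R) (k n : ℕ) :
    ∏ i ∈ range (k * n), f i = ∏ a ∈ range n, ∏ b ∈ range k, f (k * a + b) := by
  induction n with
  | zero => simp
  | succ n ih => rw [mul_add, mul_one, prod_range_add, ih, prod_range_succ]

/-- The positive integers at most `k * n` that are not congruent to `0` or `±1` modulo `k`. -/
def allowedParts (k n : ℕ) : Finset ℕ :=
  {i ∈ (range (k * n)).image (· + 1) | i % k ≠ 0 ∧ i % k ≠ 1 ∧ i % k ≠ k - 1}

lemma prod_allowedParts (f : ℕ → R) (l n : ℕ) :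
    ∏ i ∈ allowedParts (l + 3) n, f i =
      ∏ a ∈ range n, ∏ b ∈ range l, f ((l + 3) * a + (b + 2)) := by
  rw [allowedParts, prod_filter, prod_image (by simp), prod_range_mul_eq]
  refine prod_congr rfl fun a _ => ?_
  rw [prod_range_succ, prod_range_succ, prod_range_succ']
  have h0 : ((l + 3) * a + 0 + 1) % (l + 3) = 1 := by
    rw [add_assoc, Nat.mul_add_mod, Nat.mod_eq_of_lt (by omega)]
  have h1 : ((l + 3) * a + (l + 1) + 1) % (l + 3) = l + 2 := by
    rw [add_assoc, Nat.mul_add_mod, Nat.mod_eq_of_lt (by omega)]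
  have h2 : ((l + 3) * a + (l + 2) + 1) % (l + 3) = 0 := by
    rw [add_assoc, Nat.mul_add_mod, show l + 2 + 1 = l + 3 by ring, Nat.mod_self]
  rw [if_neg (by simp [h0]), if_neg (by simp [h1]), if_neg (by simp [h2]), mul_one, mul_one,
    mul_one]
  refine prod_congr rfl fun b hb => ?_
  rw [mem_range] at hb
  have h3 : ((l + 3) * a + (b + 1) + 1) % (l + 3) = b + 2 := by
    rw [add_assoc, Nat.mul_add_mod, Nat.mod_eq_of_lt (by omega)]
  rw [if_pos (by rw [h3]; omega)]
  rfl

lemma qPoch_eq_mul_prod_allowedParts (x : R) (l n : ℕ) :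
    qPoch x x ((l + 3) * n) = qPoch x (x ^ (l + 3)) n * qPoch (x ^ (l + 2)) (x ^ (l + 3)) n *
      qPoch (x ^ (l + 3)) (x ^ (l + 3)) n * ∏ i ∈ allowedParts (l + 3) n, (1 - x ^ i) := by
  rw [prod_allowedParts, qPoch, prod_range_mul_eq, qPoch, qPoch, qPoch, ← prod_mul_distrib,
    ← prod_mul_distrib, ← prod_mul_distrib]
  refine prod_congr rfl fun a _ => ?_
  rw [prod_range_succ, prod_range_succ, prod_range_succ']
  have h : ∏ b ∈ range l, (1 - x * x ^ ((l + 3) * a + (b + 1))) =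
      ∏ b ∈ range l, (1 - x ^ ((l + 3) * a + (b + 2))) :=
    prod_congr rfl fun b _ => by ring
  rw [h]
  ring

lemma alhPoly_eq_of_pow_eq_zero (hx : x ^ (w + 1) = 0) (l : ℕ) :
    alhPoly x (l + 1) (2 * w) = qPoch (-x) x (2 * w) *
      ∏ i ∈ allowedParts (l + 3) (2 * w), ∑ c ∈ range (w + 1), x ^ (c * i) := by
  have hE := qPoch_eq_mul_prod_allowedParts x l (2 * w)
  rw [qPoch_self_eq_of_le hx (show w ≤ (l + 3) * (2 * w) by nlinarith)] at hE
  have hU := isUnit_qPoch_self hx w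
  have h1 := alhPoly_mul_qPoch_of_pow_eq_zero hx (l + 1)
  rw [← triple_product_of_pow_eq_zero hx l le_rfl] at h1
  have hG : (∏ i ∈ allowedParts (l + 3) (2 * w), (1 - x ^ i)) *
      ∏ i ∈ allowedParts (l + 3) (2 * w), ∑ c ∈ range (w + 1), x ^ (c * i) = 1 := by
    rw [← prod_mul_distrib]
    refine prod_eq_one fun i hi => ?_
    have hi0 : i ≠ 0 := by
      rintro rfl
      simp [allowedParts] at hi
    simp_rw [mul_comm _ i, pow_mul]
    rw [mul_neg_geom_sum, ← pow_mul, mul_comm, pow_mul, hx, zero_pow hi0, sub_zero]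
  apply hU.mul_right_cancel
  rw [h1, hE]
  linear_combination (-(qPoch (-x) x (2 * w) * (qPoch x (x ^ (l + 3)) (2 * w) *
    qPoch (x ^ (l + 2)) (x ^ (l + 3)) (2 * w) *
      qPoch (x ^ (l + 3)) (x ^ (l + 3)) (2 * w)))) * hG

end Truncated

lemma coeff_alhPoly_X (w l : ℕ) :
    (alhPoly (Polynomial.X : Polynomial ℤ) (l + 1) (2 * w)).coeff w =
      (qPoch (-Polynomial.X) (Polynomial.X : Polynomial ℤ) (2 * w) *
        ∏ i ∈ allowedParts (l + 3) (2 * w), ∑ c ∈ range (w + 1), Polynomial.X ^ (c * i)).coeff w := by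
  let I := Ideal.span {(Polynomial.X : Polynomial ℤ) ^ (w + 1)}
  have hx : (Ideal.Quotient.mk I Polynomial.X) ^ (w + 1) = 0 := by
    rw [← map_pow, Ideal.Quotient.eq_zero_iff_mem]
    exact Ideal.mem_span_singleton_self _
  have h := alhPoly_eq_of_pow_eq_zero hx l
  rw [← map_alhPoly, ← map_neg, ← map_qPoch] at h
  simp only [← map_pow, ← map_sum, ← map_prod, ← map_mul] at h
  rw [Ideal.Quotient.mk_eq_mk_iff_sub_mem, Ideal.mem_span_singleton, Polynomial.X_pow_dvd_iff] at h
  have := h w (Nat.lt_succ_self w)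
  rwa [Polynomial.coeff_sub, sub_eq_zero] at this

section GeneratingFunction

open Polynomial

/-- `S` is a finite set of finitely supported sequences with generating function `P`
by weight. -/
def HasGenFun (S : Set (ℕ → ℕ)) (P : ℤ[X]) : Prop :=
  ∃ T : Finset (ℕ → ℕ), ↑T = S ∧ (∀ f ∈ T, (Function.support f).Finite) ∧
    ∑ f ∈ T, X ^ wt f = P

lemma coeff_sum_X_pow {α : Type*} (T : Finset α) (g : α → ℕ) (w : ℕ) :
    (∑ a ∈ T, (X : ℤ[X]) ^ g a).coeff w = #{a ∈ T | g a = w} := by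
  simp [coeff_X_pow, eq_comm]

lemma HasGenFun.ncard_eq {S : Set (ℕ → ℕ)} {P : ℤ[X]} (h : HasGenFun S P) (w : ℕ) :
    ({f | f ∈ S ∧ wt f = w}.ncard : ℤ) = P.coeff w := by
  obtain ⟨T, rfl, -, rfl⟩ := h
  rw [coeff_sum_X_pow, ← Set.ncard_coe_finset]
  simp

lemma hasGenFun_singleton {f : ℕ → ℕ} (hf : (Function.support f).Finite) :
    HasGenFun {f} (X ^ wt f) :=
  ⟨{f}, by simp, by simpa using hf, by simp⟩

lemma wt_zero : wt 0 = 0 := by simp [wt]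

lemma hasGenFun_zero : HasGenFun {0} 1 := by
  simpa [wt_zero] using hasGenFun_singleton (f := 0) (by simp)

lemma HasGenFun.biUnion {J : Finset ℕ} {S : ℕ → Set (ℕ → ℕ)} {P : ℕ → ℤ[X]}
    (h : ∀ j ∈ J, HasGenFun (S j) (P j)) (hd : (J : Set ℕ).PairwiseDisjoint S) :
    HasGenFun (⋃ j ∈ J, S j) (∑ j ∈ J, P j) := by
  classical
  choose! T hT hf hP using h
  refine ⟨J.biUnion T, ?_, ?_, ?_⟩
  · simp only [coe_biUnion]
    exact Set.iUnion₂_congr hT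
  · intro f hf'
    obtain ⟨j, hj, hfj⟩ := mem_biUnion.mp hf'
    exact hf j hj f hfj
  · rw [sum_biUnion]
    · exact sum_congr rfl hP
    · intro i hi j hj hij
      have := hd hi hj hij
      simp only [Function.onFun] at this ⊢
      rwa [← hT i hi, ← hT j hj, disjoint_coe] at this

lemma HasGenFun.union {S T : Set (ℕ → ℕ)} {P Q : ℤ[X]} (hS : HasGenFun S P)
    (hT : HasGenFun T Q) (hd : Disjoint S T) : HasGenFun (S ∪ T) (P + Q) := by
  classical
  obtain ⟨A, rfl, hA, rfl⟩ := hS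
  obtain ⟨B, rfl, hB, rfl⟩ := hT
  refine ⟨A ∪ B, by simp, ?_, sum_union (disjoint_coe.mp hd)⟩
  intro f hf
  exact (mem_union.mp hf).elim (hA f) (hB f)

lemma wt_add {f g : ℕ → ℕ} (hf : (Function.support f).Finite) (hg : (Function.support g).Finite) :
    wt (f + g) = wt f + wt g :=
  finsum_add_distrib hf hg

lemma HasGenFun.image2_add {S T : Set (ℕ → ℕ)} {P Q : ℤ[X]} (hS : HasGenFun S P)
    (hT : HasGenFun T Q)
    (hinj : ∀ f ∈ S, ∀ g ∈ T, ∀ f' ∈ S, ∀ g' ∈ T, f + g = f' + g' → f = f' ∧ g = g') :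
    HasGenFun (Set.image2 (· + ·) S T) (P * Q) := by
  classical
  obtain ⟨A, rfl, hA, rfl⟩ := hS
  obtain ⟨B, rfl, hB, rfl⟩ := hT
  refine ⟨image₂ (· + ·) A B, by simp, ?_, ?_⟩
  · intro f hf
    obtain ⟨a, ha, b, hb, rfl⟩ := mem_image₂.mp hf
    exact ((hA a ha).union (hB b hb)).subset (Function.support_add a b)
  · rw [sum_mul_sum, ← sum_product', ← image_uncurry_product, sum_image]
    · refine sum_congr rfl fun p hp => ?_
      rw [mem_product] at hp
      rw [Function.uncurry, wt_add (hA _ hp.1) (hB _ hp.2), pow_add]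
    · rintro ⟨a, b⟩ hab ⟨a', b'⟩ hab' h
      simp only [coe_product, Set.mem_prod] at hab hab'
      obtain ⟨h1, h2⟩ := hinj a hab.1 b hab.2 a' hab'.1 b' hab'.2 h
      rw [h1, h2]

/-- Nonincreasing sequences of length `d`, with entries at most `a`, placed at the positions
`j, …, j + d - 1`. -/
def boxSet (a j d : ℕ) : Set (ℕ → ℕ) :=
  {r | (∀ i < j, r i = 0) ∧ (∀ i, j + d ≤ i → r i = 0) ∧ (∀ i, j ≤ i → r (i + 1) ≤ r i) ∧ r j ≤ a}

lemma zero_mem_boxSet (a j d : ℕ) : 0 ∈ boxSet a j d := by simp [boxSet]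

lemma boxSet_zero_left (j d : ℕ) : boxSet 0 j d = {0} := by
  refine Set.eq_singleton_iff_unique_mem.mpr ⟨zero_mem_boxSet _ _ _, ?_⟩
  rintro r ⟨h1, -, h3, h4⟩
  funext i
  rcases lt_or_ge i j with h | h
  · exact h1 i h
  · induction i, h using Nat.le_induction with
    | base => simpa using h4
    | succ i hi ih => have := h3 i hi; simp at ih ⊢; omega

lemma boxSet_zero_right (a j : ℕ) : boxSet a j 0 = {0} := by
  refine Set.eq_singleton_iff_unique_mem.mpr ⟨zero_mem_boxSet _ _ _, ?_⟩
  rintro r ⟨h1, h2, -, -⟩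
  funext i
  exact (lt_or_ge i j).elim (h1 i) (h2 i)

lemma boxSet_succ_succ (a j d : ℕ) : boxSet (a + 1) j (d + 1) =
    boxSet a j (d + 1) ∪ Set.image2 (· + ·) {Pi.single j (a + 1)} (boxSet (a + 1) (j + 1) d) := by
  ext r
  simp only [Set.image2_singleton_left, Set.mem_union, Set.mem_image]
  constructor
  · rintro ⟨h1, h2, h3, h4⟩
    rcases Nat.lt_or_ge (r j) (a + 1) with h | h
    · exact Or.inl ⟨h1, h2, h3, by omega⟩
    · refine Or.inr ⟨Function.update r j 0, ⟨?_, ?_, ?_, ?_⟩, ?_⟩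
      · intro i hi
        by_cases hij : i = j
        · simp [hij]
        · simpa [hij] using h1 i (by omega)
      · intro i hi
        simpa [show i ≠ j by omega] using h2 i (by omega)
      · intro i hi
        simpa [show i ≠ j by omega, show i + 1 ≠ j by omega] using h3 i (by omega)
      · simpa using (h3 j le_rfl).trans h4
      · funext i
        by_cases hij : i = j
        · subst hij; simp; omega
        · simp [hij]
  · rintro (⟨h1, h2, h3, h4⟩ | ⟨r, ⟨h1, h2, h3, h4⟩, rfl⟩)
    · exact ⟨h1, h2, h3, by omega⟩
    · refine ⟨?_, ?_, ?_, ?_⟩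
      · intro i hi
        simpa [show i ≠ j by omega] using h1 i (by omega)
      · intro i hi
        simpa [show i ≠ j by omega] using h2 i (by omega)
      · intro i hi
        rcases hi.eq_or_lt with rfl | hi
        · simpa using h4.trans (Nat.le_add_right _ _)
        · simpa [show i ≠ j by omega, show i + 1 ≠ j by omega] using h3 i hi
      · simpa using h1 j (by omega)

lemma wt_single (j c : ℕ) : wt (Pi.single j c) = c := by
  rw [wt, finsum_eq_single _ j fun i hi => by simp [hi]]; simp

lemma hasGenFun_boxSet (a j d : ℕ) : HasGenFun (boxSet a j d) (gaussBinom X (a + d) a) := by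
  induction a generalizing j d with
  | zero => rw [boxSet_zero_left]; simpa using hasGenFun_zero
  | succ a iha =>
    induction d generalizing j with
    | zero => rw [boxSet_zero_right]; simpa using hasGenFun_zero
    | succ d ihd =>
      have hs := hasGenFun_singleton (f := Pi.single j (a + 1))
        ((Set.finite_singleton j).subset Pi.support_single_subset)
      rw [wt_single] at hs
      rw [boxSet_succ_succ, ← add_assoc, gaussBinom_succ_succ,
        show gaussBinom (X : ℤ[X]) (a + 1 + d) a = gaussBinom X (a + (d + 1)) a by
          congr 1; ring]
      refine (iha j (d + 1)).union (hs.image2_add (ihd (j + 1)) ?_) ?_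
      · rintro f rfl g - f' rfl g' - h
        exact ⟨rfl, add_left_cancel h⟩
      · rw [Set.disjoint_left]
        rintro r ⟨-, -, -, h4⟩ ⟨_, rfl, r', -, rfl⟩
        simp at h4
        omega

/-- Anti-lecture hall compositions with at most `n` parts and first part at most `m`. -/
def alhSet (m n : ℕ) : Set (ℕ → ℕ) :=
  {f | (∀ i, (i + 1) * f (i + 1) ≤ (i + 2) * f i) ∧ f 0 ≤ m ∧ ∀ i, n ≤ i → f i = 0}

lemma alhSet_zero (n : ℕ) : alhSet 0 n = {0} := by
  refine Set.eq_singleton_iff_unique_mem.mpr ⟨by simp [alhSet], ?_⟩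
  rintro f ⟨h1, h2, -⟩
  funext i
  induction i with
  | zero => simpa using h2
  | succ i ih =>
    have := h1 i
    rw [ih] at this
    simpa using this

/-- The staircase `1, 2, …, j`. -/
def stair (j i : ℕ) : ℕ := if i < j then i + 1 else 0

lemma support_stair_finite (j : ℕ) : (Function.support (stair j)).Finite := by
  refine (Set.finite_Iio j).subset fun i hi => ?_
  by_contra h
  exact hi (if_neg h)

lemma wt_stair (j : ℕ) : wt (stair j) = (j + 1).choose 2 := by
  rw [wt, finsum_eq_sum_of_support_subset (s := range j), Nat.choose_two_right,
    ← sum_range_id, sum_range_succ']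
  · rw [add_zero]
    refine sum_congr rfl fun i hi => ?_
    rw [mem_range] at hi
    simp [stair, hi]
  · intro i hi
    by_contra h
    exact hi (if_neg (by simpa using h))

lemma alhSet_succ (m n : ℕ) : alhSet (m + 1) n = ⋃ j ∈ range (n + 1),
    Set.image2 (· + ·) (Set.image2 (· + ·) (alhSet m j) {stair j}) (boxSet j j (n - j)) := by
  ext f
  simp only [Set.mem_iUnion, Set.image2_singleton_right, mem_range]
  constructor
  · rintro ⟨h1, h2, h3⟩
    have hex : ∃ i, f i ≤ i := ⟨n, by simp [h3 n le_rfl]⟩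
    obtain ⟨j, hj, hmin⟩ : ∃ j, f j ≤ j ∧ ∀ i < j, i + 1 ≤ f i :=
      ⟨Nat.find hex, Nat.find_spec hex, fun i hi => by have := Nat.find_min hex hi; omega⟩
    have hjn : j ≤ n := by
      by_contra h
      have := hmin n (by omega)
      rw [h3 n le_rfl] at this
      omega
    have hle : ∀ i, j ≤ i → f i ≤ i := by
      intro i hi
      induction i, hi using Nat.le_induction with
      | base => exact hj
      | succ i _ ih => have := h1 i; nlinarith
    refine ⟨j, by omega, _, ⟨fun i => if i < j then f i - (i + 1) else 0, ⟨?_, ?_, ?_⟩, rfl⟩,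
      fun i => if i < j then 0 else f i, ⟨?_, ?_, ?_, ?_⟩, ?_⟩
    · intro i
      by_cases hi : i + 1 < j
      · obtain ⟨a, ha⟩ := Nat.exists_eq_add_of_le (hmin i (by omega))
        obtain ⟨b, hb⟩ := Nat.exists_eq_add_of_le (hmin (i + 1) hi)
        have := h1 i
        simp only [hi, show i < j by omega, if_true, ha, hb, Nat.add_sub_cancel_left] at this ⊢
        nlinarith
      · simp [hi]
    · dsimp only
      split_ifs <;> omega
    · intro i hi
      simp [show ¬ i < j by omega]
    · intro i hi
      simp [hi]
    · intro i hi
      simp [show ¬ i < j by omega, h3 i (by omega)]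
    · intro i hi
      simp only [show ¬ i < j by omega, show ¬ i + 1 < j by omega, if_false]
      have := h1 i
      have := hle i hi
      nlinarith
    · simpa using hj
    · funext i
      by_cases hi : i < j
      · have := hmin i hi
        simp [hi, stair]
        omega
      · simp [hi, stair]
  · rintro ⟨j, hjn, _, ⟨g, ⟨g1, g2, g3⟩, rfl⟩, r, ⟨r1, r2, r3, r4⟩, rfl⟩
    refine ⟨fun i => ?_, ?_, fun i hi => ?_⟩
    · rcases lt_trichotomy (i + 1) j with hi | hi | hi
      · have := g1 i
        simp only [Pi.add_apply, stair, hi, show i < j by omega, if_true, r1 i (by omega),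
          r1 (i + 1) hi]
        nlinarith
      · simp only [Pi.add_apply, stair, show i < j by omega, show ¬ i + 1 < j by omega, if_true,
          if_false, r1 i (by omega), g3 (i + 1) (by omega)]
        rw [← hi] at r4
        nlinarith
      · simp only [Pi.add_apply, stair, show ¬ i < j by omega, show ¬ i + 1 < j by omega,
          if_false, g3 i (by omega), g3 (i + 1) (by omega)]
        have := r3 i (by omega)
        nlinarith
    · rcases Nat.eq_zero_or_pos j with rfl | hj
      · simp [stair, g3 0 le_rfl]
        omega
      · simp [stair, hj, r1 0 hj, g2]
    · simp [g3 i (by omega), r2 i (by omega), stair, show ¬ i < j by omega]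

lemma hasGenFun_alhSet (m n : ℕ) : HasGenFun (alhSet m n) (alhPoly X m n) := by
  induction m generalizing n with
  | zero => rw [alhSet_zero]; exact hasGenFun_zero
  | succ m ih =>
    rw [alhSet_succ, alhPoly]
    refine HasGenFun.biUnion (fun j hj => ?_) ?_
    · rw [mem_range] at hj
      have hs := hasGenFun_singleton (support_stair_finite j)
      have hb := hasGenFun_boxSet j j (n - j)
      rw [wt_stair] at hs
      rw [show j + (n - j) = n by omega] at hb
      rw [mul_assoc, mul_comm, mul_comm (X ^ _)]
      refine ((ih j).image2_add hs ?_).image2_add hb ?_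
      · rintro f - g rfl f' - g' rfl h
        exact ⟨add_right_cancel h, rfl⟩
      · rintro _ ⟨g, hg, _, rfl, rfl⟩ r hr _ ⟨g', hg', _, rfl, rfl⟩ r' hr' h
        have hrr : r = r' := by
          funext i
          by_cases hi : i < j
          · rw [hr.1 i hi, hr'.1 i hi]
          · have := congrFun h i
            simpa [hg.2.2 i (by omega), hg'.2.2 i (by omega)] using this
        subst hrr
        exact ⟨add_right_cancel h, rfl⟩
    · have hlt : ∀ i j, i < j → ∀ f, f ∈ Set.image2 (· + ·)
          (Set.image2 (· + ·) (alhSet m i) {stair i}) (boxSet i i (n - i)) →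
          f ∉ Set.image2 (· + ·)
          (Set.image2 (· + ·) (alhSet m j) {stair j}) (boxSet j j (n - j)) := by
        rintro i j hij _ ⟨_, ⟨g, hg, _, rfl, rfl⟩, r, hr, rfl⟩
          ⟨_, ⟨g', hg', _, rfl, rfl⟩, r', hr', h⟩
        have h := congrFun h i
        have := hr.2.2.2
        simp [stair, hij, hg.2.2 i le_rfl] at h
        omega
      intro i _ j _ hij
      rw [Function.onFun, Set.disjoint_left]
      rcases hij.lt_or_gt with hij | hij
      · exact hlt i j hij
      · exact fun f hf hf' => hlt j i hij f hf' hf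

lemma Fset_eq (m : ℕ) {n w : ℕ} (hn : w ≤ n) : Fset m w = {f | f ∈ alhSet m n ∧ wt f = w} := by
  ext f
  constructor
  · rintro ⟨⟨hfin, h1⟩, h2, h3⟩
    refine ⟨⟨h1, h2, fun i hi => ?_⟩, h3⟩
    by_contra hne
    have hpos : ∀ d ≤ i, f (i - d) ≠ 0 := by
      intro d hd
      induction d with
      | zero => exact hne
      | succ d ih =>
        intro h0
        have := h1 (i - (d + 1))
        rw [h0, show i - (d + 1) + 1 = i - d by omega] at this
        have h := ih (by omega)
        simp at this
        omega
    have hsub : range (i + 1) ⊆ hfin.toFinset := by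
      intro a ha
      rw [mem_range] at ha
      have := hpos (i - a) (by omega)
      rw [show i - (i - a) = a by omega] at this
      simpa using this
    have hcard : i + 1 ≤ wt f := by
      rw [wt, finsum_eq_sum f hfin]
      have h := card_nsmul_le_sum hfin.toFinset f 1 fun a ha => by
        simpa [Nat.one_le_iff_ne_zero] using ha
      have hc := card_le_card hsub
      rw [card_range] at hc
      rw [smul_eq_mul, mul_one] at h
      exact hc.trans h
    omega
  · rintro ⟨⟨h1, h2, h3⟩, h4⟩
    refine ⟨⟨(Set.finite_Iio n).subset fun i hi => ?_, h1⟩, h2, h4⟩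
    by_contra h
    exact hi (h3 i (by simpa using h))

end GeneratingFunction

section Overpartitions

open Polynomial

/-- The finite set of pairs (set of overlined parts, multiplicities of the allowed non-overlined
parts), with all parts and multiplicities large enough for overpartitions of `w`. -/
def overpartitionData (A : Finset ℕ) (n w : ℕ) : Finset (Finset ℕ × ((a : ℕ) → a ∈ A → ℕ)) :=
  ((range n).image (· + 1)).powerset ×ˢ A.pi fun _ => range (w + 1)

/-- The multiset with prescribed multiplicities. -/
def multisetOfCounts (A : Finset ℕ) (c : (a : ℕ) → a ∈ A → ℕ) : Multiset ℕ :=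
  ∑ a ∈ A.attach, Multiset.replicate (c a.1 a.2) a.1

lemma count_multisetOfCounts (A : Finset ℕ) (c : (a : ℕ) → a ∈ A → ℕ) {a : ℕ} (ha : a ∈ A) :
    (multisetOfCounts A c).count a = c a ha := by
  rw [multisetOfCounts, Multiset.count_sum', sum_eq_single (⟨a, ha⟩ : A)]
  · simp
  · rintro ⟨b, hb⟩ - hne
    rw [Multiset.count_replicate, if_neg fun h => hne (Subtype.ext h)]
  · simp

lemma mem_of_mem_multisetOfCounts {A : Finset ℕ} {c : (a : ℕ) → a ∈ A → ℕ} {a : ℕ}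
    (ha : a ∈ multisetOfCounts A c) : a ∈ A := by
  obtain ⟨b, -, hb⟩ := Multiset.mem_sum.mp ha
  rw [Multiset.eq_of_mem_replicate hb]
  exact b.2

lemma sum_multisetOfCounts (A : Finset ℕ) (c : (a : ℕ) → a ∈ A → ℕ) :
    (multisetOfCounts A c).sum = ∑ a ∈ A.attach, c a.1 a.2 * a.1 := by
  rw [multisetOfCounts, ← Multiset.coe_sumAddMonoidHom, map_sum]
  simp

lemma qPoch_neg_X_mul_prod (A : Finset ℕ) (n w : ℕ) :
    qPoch (-X) (X : ℤ[X]) n * ∏ i ∈ A, ∑ c ∈ range (w + 1), X ^ (c * i) =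
      ∑ p ∈ overpartitionData A n w, X ^ (∑ i ∈ p.1, i + (multisetOfCounts A p.2).sum) := by
  have h : qPoch (-X) (X : ℤ[X]) n =
      ∑ t ∈ ((range n).image (· + 1)).powerset, X ^ ∑ i ∈ t, i := by
    simp_rw [← prod_pow_eq_pow_sum]
    rw [← prod_one_add, prod_image (by simp), qPoch]
    exact prod_congr rfl fun i _ => by ring
  rw [h, prod_sum, sum_mul_sum, ← sum_product']
  refine sum_congr rfl fun p _ => ?_
  rw [sum_multisetOfCounts, pow_add, prod_pow_eq_pow_sum]

lemma mem_allowedParts {k n i : ℕ} : i ∈ allowedParts k n ↔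
    (0 < i ∧ i ≤ k * n) ∧ i % k ≠ 0 ∧ i % k ≠ 1 ∧ i % k ≠ k - 1 := by
  rw [allowedParts, mem_filter]
  refine and_congr_left fun _ => ?_
  simp only [mem_image, mem_range]
  constructor
  · rintro ⟨j, hj, rfl⟩; omega
  · exact fun h => ⟨i - 1, by omega, by omega⟩

lemma Hset_eq_image {k n w : ℕ} (hk : 0 < k) (hn : w ≤ n) :
    Hset k w = (fun p : Finset ℕ × ((a : ℕ) → a ∈ allowedParts k n → ℕ) =>
        (p.1.val, multisetOfCounts _ p.2)) ''
      ((overpartitionData (allowedParts k n) n w).filter fun p =>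
        ∑ i ∈ p.1, i + (multisetOfCounts _ p.2).sum = w : Finset _) := by
  ext ⟨μ, ν⟩
  simp only [Set.mem_image, mem_coe, mem_filter, Prod.mk.injEq, overpartitionData,
    mem_product, mem_powerset, mem_pi, mem_range]
  constructor
  · rintro ⟨h1, h2, h3, h4⟩
    simp only at h1 h2 h3 h4
    have hν : multisetOfCounts (allowedParts k n) (fun a _ => ν.count a) = ν := by
      ext a
      by_cases ha : a ∈ allowedParts k n
      · rw [count_multisetOfCounts _ _ ha]
      · rw [Multiset.count_eq_zero_of_notMem fun h => ha (mem_of_mem_multisetOfCounts h),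
          eq_comm, Multiset.count_eq_zero]
        intro h
        have := Multiset.le_sum_of_mem h
        refine ha (mem_allowedParts.mpr ⟨⟨(h3 a h).1, ?_⟩, (h3 a h).2⟩)
        have := Nat.le_mul_of_pos_left n hk
        omega
    refine ⟨(⟨μ, h1⟩, fun a _ => ν.count a), ⟨⟨?_, ?_⟩, ?_⟩, rfl, hν⟩
    · intro a ha
      have h := Multiset.le_sum_of_mem (show a ∈ μ from ha)
      have := h2 a ha
      exact mem_image.mpr ⟨a - 1, by rw [mem_range]; omega, by omega⟩
    · intro a _
      change ν.count a < w + 1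
      have h := Multiset.card_nsmul_le_sum (s := ν) (a := 1) fun x hx => (h3 x hx).1
      have := Multiset.count_le_card a ν
      rw [smul_eq_mul, mul_one] at h
      omega
    · rw [hν, ← h4, Finset.sum_eq_multiset_sum, Multiset.map_id']
  · rintro ⟨⟨t, c⟩, ⟨⟨h1, -⟩, h3⟩, rfl, rfl⟩
    refine ⟨t.nodup, fun a ha => ?_, fun a ha => ?_, ?_⟩
    · obtain ⟨b, -, rfl⟩ := mem_image.mp (h1 ha)
      exact b.succ_pos
    · have h := mem_allowedParts.mp (mem_of_mem_multisetOfCounts (A := allowedParts k n) (c := c) ha)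
      exact ⟨h.1.1, h.2⟩
    · rw [← h3, Finset.sum_eq_multiset_sum, Multiset.map_id']

lemma ncard_Hset {k n w : ℕ} (hk : 0 < k) (hn : w ≤ n) :
    ((Hset k w).ncard : ℤ) = (qPoch (-X) (X : ℤ[X]) n *
      ∏ i ∈ allowedParts k n, ∑ c ∈ range (w + 1), X ^ (c * i)).coeff w := by
  rw [qPoch_neg_X_mul_prod, coeff_sum_X_pow, Hset_eq_image hk hn, Set.ncard_image_of_injective,
    Set.ncard_coe_finset]
  rintro ⟨t, c⟩ ⟨t', c'⟩ h
  obtain ⟨h1, h2⟩ := Prod.mk.inj h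
  refine Prod.ext (Finset.val_injective h1) ?_
  funext a ha
  change c a ha = c' a ha
  rw [← count_multisetOfCounts _ c ha, ← count_multisetOfCounts _ c' ha]
  exact congrArg _ h2

end Overpartitions

end ALHOverpartitions

/-- For `k ≥ 3` and `n ≥ 1`, the number of anti-lecture hall compositions of `n` with first
entry at most `k-2` equals the number of overpartitions of `n` whose non-overlined parts are
not congruent to `0, ±1` modulo `k`: `|F_{k-2}(n)| = |H_k(n)|`. -/
theorem alh_eq_overpartitions (k n : ℕ) (hk : 3 ≤ k) (hn : 0 < n) :
    (Fset (k - 2) n).ncard = (Hset k n).ncard := by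
  obtain ⟨l, rfl⟩ := Nat.exists_eq_add_of_le' hk
  have hle : n ≤ 2 * n := by omega
  rw [show l + 3 - 2 = l + 1 by omega, Fset_eq (l + 1) hle, ← Nat.cast_inj (R := ℤ),
    (hasGenFun_alhSet (l + 1) (2 * n)).ncard_eq, coeff_alhPoly_X, ncard_Hset (by omega) hle]
end

section
/- For every integer k ≥ 2 and every positive integer n, the number of anti-lecture hall compositions of weight n with first entry at most 2k−2 equals the number of overpartitions of n whose non-overlined parts are not congruent to 0, 1, or −1 modulo 2k; that is, |F_{2k−2}(n)| = |H_{2k}(n)|. -/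
namespace AntiLectureHall

open Finset

section QSeries

variable {R : Type*} [CommRing R]

/-- The `q`-Pochhammer symbol `(a; q)_n`. -/
def qPoch (a q : R) (n : ℕ) : R := ∏ i ∈ range n, (1 - a * q ^ i)

/-- The Gaussian binomial coefficient, defined by the `q`-Pascal recursion. -/
def qBinom (q : R) : ℕ → ℕ → R
  | _, 0 => 1
  | 0, _ + 1 => 0
  | n + 1, k + 1 => qBinom q n k + q ^ (k + 1) * qBinom q n (k + 1)

lemma qBinom_zero_right (q : R) (n : ℕ) : qBinom q n 0 = 1 := by
  cases n <;> rfl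

lemma qBinom_succ_succ (q : R) (n k : ℕ) :
    qBinom q (n + 1) (k + 1) = qBinom q n k + q ^ (k + 1) * qBinom q n (k + 1) := rfl

lemma qBinom_eq_zero_of_lt (q : R) {n k : ℕ} (h : n < k) : qBinom q n k = 0 := by
  induction n generalizing k with
  | zero => obtain ⟨k, rfl⟩ := Nat.exists_eq_succ_of_ne_zero h.ne'; rfl
  | succ n ih =>
    obtain ⟨k, rfl⟩ := Nat.exists_eq_succ_of_ne_zero (Nat.ne_zero_of_lt h)
    rw [Nat.succ_eq_add_one, qBinom_succ_succ, ih (by omega), ih (by omega)]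
    ring

lemma qBinom_self (q : R) (n : ℕ) : qBinom q n n = 1 := by
  induction n with
  | zero => rfl
  | succ n ih => rw [qBinom_succ_succ, ih, qBinom_eq_zero_of_lt q n.lt_succ_self]; ring

lemma qPoch_zero (a q : R) : qPoch a q 0 = 1 := by simp [qPoch]

lemma qPoch_succ (a q : R) (n : ℕ) : qPoch a q (n + 1) = qPoch a q n * (1 - a * q ^ n) := by
  simp [qPoch, prod_range_succ]

lemma qPoch_add (a q : R) (m n : ℕ) :
    qPoch a q (m + n) = qPoch a q m * qPoch (a * q ^ m) q n := by
  simp only [qPoch, prod_range_add, pow_add, mul_assoc]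

lemma choose_succ_two (n : ℕ) : (n + 1).choose 2 = n.choose 2 + n := by
  rw [Nat.choose_succ_succ' n 1, Nat.choose_one_right, add_comm]

lemma choose_add_two (m n : ℕ) : (m + n).choose 2 = m.choose 2 + n.choose 2 + m * n := by
  induction n with
  | zero => simp
  | succ n ih => rw [← add_assoc, choose_succ_two, choose_succ_two, ih]; ring

lemma sq_eq_two_mul_choose_two_add (n : ℕ) : n * n = 2 * n.choose 2 + n := by
  induction n with
  | zero => simp
  | succ n ih => rw [choose_succ_two]; linarith

lemma qBinom_mul_qPoch (q : R) (k l : ℕ) :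
    qBinom q (k + l) k * (qPoch q q k * qPoch q q l) = qPoch q q (k + l) := by
  induction k generalizing l with
  | zero => simp [qBinom_zero_right, qPoch_zero]
  | succ k ihk =>
    induction l with
    | zero => simp [qBinom_self, qPoch_zero]
    | succ l ihl =>
      have h1 := ihk (l + 1)
      rw [show k + 1 + (l + 1) = (k + 1 + l) + 1 by ring, qBinom_succ_succ]
      rw [show k + (l + 1) = k + 1 + l by ring] at h1
      rw [qPoch_succ q q (k + 1 + l)]
      have h2 := qPoch_succ q q k
      have h3 := qPoch_succ q q l
      linear_combination (1 - q * q ^ k) * h1 + q ^ (k + 1) * (1 - q * q ^ l) * ihl +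
        qBinom q (k + 1 + l) k * qPoch q q (l + 1) * h2 +
        q ^ (k + 1) * qBinom q (k + 1 + l) (k + 1) * qPoch q q (k + 1) * h3

lemma qBinom_eq {q : R} {w : ℕ → R} (hw : ∀ n, qPoch q q n * w n = 1) (k l : ℕ) :
    qBinom q (k + l) k = qPoch q q (k + l) * (w k * w l) := by
  linear_combination (w k * w l) * qBinom_mul_qPoch q k l -
    qBinom q (k + l) k * qPoch q q l * w l * hw k - qBinom q (k + l) k * hw l

lemma sum_qBinom_succ (q : R) (N : ℕ) (f : ℕ → R) :
    ∑ t ∈ range (N + 2), qBinom q (N + 1) t * f t =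
      ∑ t ∈ range (N + 1), qBinom q N t * (f (t + 1) + q ^ t * f t) := by
  have h : ∑ t ∈ range (N + 1), qBinom q N t * (q ^ t * f t) =
      ∑ t ∈ range (N + 1), q ^ (t + 1) * qBinom q N (t + 1) * f (t + 1) + f 0 := by
    have := sum_range_succ' (fun t => qBinom q N t * (q ^ t * f t)) (N + 1)
    rw [sum_range_succ, qBinom_eq_zero_of_lt q N.lt_succ_self] at this
    simp only [zero_mul, add_zero, qBinom_zero_right, pow_zero, one_mul] at this
    rw [this]
    congr 1
    exact sum_congr rfl fun _ _ => by ring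
  rw [sum_range_succ']
  simp only [qBinom_succ_succ, mul_add, sum_add_distrib, add_mul, h, qBinom_zero_right]
  ring

/-- A homogeneous form of the `q`-Chu–Vandermonde summation. -/
theorem sum_qBinom_mul_qPoch_mul_prod (q a b w : R) (N : ℕ) :
    ∑ t ∈ range (N + 1), qBinom q N t * ((-b) ^ t * q ^ t.choose 2 * qPoch a q t *
      ∏ i ∈ range (N - t), (w - a * b * q ^ (t + i))) = ∏ i ∈ range N, (w - b * q ^ i) := by
  induction N generalizing b with
  | zero => simp [qBinom_zero_right, qPoch_zero]
  | succ N ih =>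
    rw [sum_qBinom_succ, prod_range_succ']
    have h1 : ∏ i ∈ range N, (w - b * q ^ (i + 1)) = ∏ i ∈ range N, (w - b * q * q ^ i) :=
      prod_congr rfl fun _ _ => by ring
    rw [h1, ← ih (b * q), sum_mul]
    refine sum_congr rfl fun t ht => ?_
    have ht : t ≤ N := by simpa [Nat.lt_succ_iff] using ht
    have h2 : ∏ i ∈ range (N - t), (w - a * b * q ^ (t + 1 + i)) =
        ∏ i ∈ range (N - t), (w - a * (b * q) * q ^ (t + i)) :=
      prod_congr rfl fun _ _ => by ring
    rw [show N + 1 - (t + 1) = N - t by omega, show N + 1 - t = N - t + 1 by omega,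
      prod_range_succ' _ (N - t)]
    have h3 : ∏ i ∈ range (N - t), (w - a * b * q ^ (t + (i + 1))) =
        ∏ i ∈ range (N - t), (w - a * (b * q) * q ^ (t + i)) :=
      prod_congr rfl fun _ _ => by ring
    rw [h2, h3, choose_succ_two, qPoch_succ]
    ring

/-- The summation behind the Bailey chain with `ρ₁ → ∞`, `ρ₂ = -q` relative to `q`. -/
lemma sum_qBinom_mul_qPoch_neg (q : R) (r N : ℕ) :
    ∑ t ∈ range (N + 1), qBinom q N t * (q ^ ((t + 1).choose 2 + r * t) *
      qPoch (-q ^ (r + 1)) q t * qPoch (q ^ (2 * r + 2 + t)) q (N - t)) =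
      qPoch (-q ^ (r + 1)) q N := by
  have := sum_qBinom_mul_qPoch_mul_prod q (-q ^ (r + 1)) (-q ^ (r + 1)) 1 N
  rw [← qPoch] at this
  rw [← this]
  refine sum_congr rfl fun t _ => ?_
  congr 1
  have h : ∏ i ∈ range (N - t), (1 - -q ^ (r + 1) * -q ^ (r + 1) * q ^ (t + i)) =
      qPoch (q ^ (2 * r + 2 + t)) q (N - t) := prod_congr rfl fun _ _ => by ring
  rw [h, choose_succ_two, neg_neg]
  ring

lemma sum_range_two_mul_add_two (n : ℕ) (f : ℕ → R) :
    ∑ t ∈ range (2 * n + 2), f t = ∑ r ∈ range (n + 1), (f (n - r) + f (n + 1 + r)) := by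
  rw [show 2 * n + 2 = (n + 1) + (n + 1) by ring, sum_range_add, sum_add_distrib]
  congr 1
  rw [← sum_range_reflect]
  exact sum_congr rfl fun r _ => by congr 1

lemma prod_range_mul_pow (x q : R) (n : ℕ) :
    ∏ i ∈ range n, (x * q ^ i) = x ^ n * q ^ n.choose 2 := by
  induction n with
  | zero => simp
  | succ n ih => rw [prod_range_succ, ih, choose_succ_two]; ring

/-- The coefficients of the theta series `∑ (-1)^r x^{r(r-1)/2} y^{r(r+1)/2} (1 - x^{2r+1})`. -/
def thetaCoeff (x y : R) (r : ℕ) : R :=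
  (-1) ^ r * x ^ r.choose 2 * y ^ (r + 1).choose 2 * (1 - x ^ (2 * r + 1))

/-- A finite form of the Jacobi triple product identity. -/
theorem qPoch_mul_sum_thetaCoeff [IsDomain R] {x y q : R} (hx : x ≠ 0) (hy : y ≠ 0)
    (hq : x * y = q) {w : ℕ → R} (hw : ∀ n, qPoch q q n * w n = 1) (n : ℕ) :
    qPoch q q (2 * n + 1) * ∑ r ∈ range (n + 1), thetaCoeff x y r * (w (n - r) * w (n + r + 1)) =
      qPoch x q (n + 1) * qPoch y q n := by
  have hq0 : q ≠ 0 := hq ▸ mul_ne_zero hx hy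
  have key := sum_qBinom_mul_qPoch_mul_prod q 0 x (q ^ n) (2 * n + 1)
  have hprod : ∏ i ∈ range (2 * n + 1), (q ^ n - x * q ^ i) =
      ((-x) ^ n * q ^ (n * (n + 1) + n.choose 2)) * (qPoch x q (n + 1) * qPoch y q n) := by
    rw [show 2 * n + 1 = n + (n + 1) by ring, prod_range_add]
    have h1 : ∏ i ∈ range (n + 1), (q ^ n - x * q ^ (n + i)) =
        q ^ (n * (n + 1)) * qPoch x q (n + 1) := by
      rw [pow_mul, qPoch, ← card_range (n + 1), ← prod_const, card_range, ← prod_mul_distrib]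
      exact prod_congr rfl fun _ _ => by ring
    have h2 : ∏ i ∈ range n, (q ^ n - x * q ^ i) =
        (-x) ^ n * q ^ n.choose 2 * qPoch y q n := by
      rw [← prod_range_mul_pow, qPoch, ← prod_range_reflect (fun i => 1 - y * q ^ i),
        ← prod_mul_distrib]
      refine prod_congr rfl fun i hi => ?_
      obtain ⟨j, rfl⟩ := Nat.exists_eq_add_of_lt (mem_range.1 hi)
      rw [show i + j + 1 - 1 - i = j by omega, ← hq]
      ring
    rw [h1, h2]
    ring
  rw [hprod, sum_range_two_mul_add_two] at key
  refine mul_left_cancel₀ (mul_ne_zero (pow_ne_zero n (neg_ne_zero.2 hx))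
    (pow_ne_zero (n * (n + 1) + n.choose 2) hq0)) ?_
  rw [← key, mul_sum, mul_sum]
  refine sum_congr rfl fun r hr => ?_
  obtain ⟨s, rfl⟩ := Nat.exists_eq_add_of_le (Nat.lt_succ_iff.1 (mem_range.1 hr))
  have hb1 := qBinom_eq hw s (2 * r + s + 1)
  have hb2 := qBinom_eq hw (2 * r + s + 1) s
  rw [show s + (2 * r + s + 1) = 2 * (r + s) + 1 by ring] at hb1
  rw [show (2 * r + s + 1) + s = 2 * (r + s) + 1 by ring] at hb2
  simp only [zero_mul, sub_zero, prod_const, card_range]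
  rw [show r + s - r = s by omega, show r + s + 1 + r = 2 * r + s + 1 by ring,
    show 2 * (r + s) + 1 - s = 2 * r + s + 1 by omega,
    show 2 * (r + s) + 1 - (2 * r + s + 1) = s by omega, hb1, hb2,
    show r + s + r + 1 = 2 * r + s + 1 by ring]
  have hp : ∀ t, qPoch 0 q t = 1 := fun t => by simp [qPoch]
  have e0 : (r + s).choose 2 = r.choose 2 + s.choose 2 + r * s := choose_add_two r s
  have e1 : (2 * r + s + 1).choose 2 =
      4 * r.choose 2 + 3 * r + s.choose 2 + 2 * r * s + s := by
    rw [choose_succ_two, choose_add_two, two_mul, choose_add_two,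
      sq_eq_two_mul_choose_two_add r]
    ring
  have er := sq_eq_two_mul_choose_two_add r
  have e2 : s.choose 2 + (r + s) * (2 * r + s + 1) =
      ((r + s) * (r + s + 1) + (r + s).choose 2) + (r + 1).choose 2 := by
    rw [e0, choose_succ_two]
    linarith
  have e3 : (2 * r + s + 1).choose 2 + (r + s) * s =
      ((r + s) * (r + s + 1) + (r + s).choose 2) + (r + 1).choose 2 := by
    rw [e0, e1, choose_succ_two]
    linarith
  have f1 : q ^ s.choose 2 * (q ^ (r + s)) ^ (2 * r + s + 1) =
      q ^ ((r + s) * (r + s + 1) + (r + s).choose 2) * q ^ (r + 1).choose 2 := by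
    rw [← pow_mul, ← pow_add, e2, pow_add]
  have f2 : q ^ (2 * r + s + 1).choose 2 * (q ^ (r + s)) ^ s =
      q ^ ((r + s) * (r + s + 1) + (r + s).choose 2) * q ^ (r + 1).choose 2 := by
    rw [← pow_mul, ← pow_add, e3, pow_add]
  have f3 : q ^ (r + 1).choose 2 = x ^ r.choose 2 * x ^ r * y ^ (r + 1).choose 2 := by
    rw [← hq, mul_pow, ← pow_add, ← choose_succ_two]
  have g1 : (-x) ^ s * x ^ r = (-x) ^ (r + s) * (-1) ^ r := by
    have h : (-1 : R) ^ r * (-1) ^ r = 1 := by rw [← mul_pow]; simp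
    rw [pow_add, neg_pow x r]
    linear_combination (-(x ^ r * (-x) ^ s)) * h
  have g2 : (-x) ^ (2 * r + s + 1) * x ^ r = -((-x) ^ (r + s) * (-1) ^ r * x ^ (2 * r + 1)) := by
    rw [show 2 * r + s + 1 = (r + s) + (r + 1) by ring, pow_add _ (r + s), neg_pow x (r + 1)]
    ring
  rw [hp, hp, thetaCoeff]
  set E := (r + s) * (r + s + 1) + (r + s).choose 2
  set T := qPoch q q (2 * (r + s) + 1) * (w s * w (2 * r + s + 1))
  set Z := x ^ r.choose 2 * y ^ (r + 1).choose 2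
  linear_combination (-T) * (-x) ^ s * f1 - T * (-x) ^ (2 * r + s + 1) * f2 -
    T * ((-x) ^ s + (-x) ^ (2 * r + s + 1)) * q ^ E * f3 - T * q ^ E * Z * g1 - T * q ^ E * Z * g2

/-- The iterates of `G ↦ (n ↦ ∑ s, q^{s(s+1)/2} [n, s] G s)` on the sequence `1, 0, 0, …`. -/
def chain (q : R) : ℕ → ℕ → R
  | 0, n => if n = 0 then 1 else 0
  | j + 1, n => ∑ s ∈ range (n + 1), q ^ (s + 1).choose 2 * (qBinom q n s * chain q j s)

/-- One step of the Bailey chain, on a single coefficient. -/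
lemma bailey_step {q : R} {w : ℕ → R} (hw : ∀ n, qPoch q q n * w n = 1) (r N : ℕ) :
    ∑ t ∈ range (N + 1), q ^ (r + t + 1).choose 2 * (qBinom q (r + N) (r + t) *
      (qPoch q q (r + t) * qPoch (-q) q (r + t) * (w t * w (r + t + r + 1)))) =
    q ^ (r + 1).choose 2 * (qPoch q q (r + N) * qPoch (-q) q (r + N) *
      (w N * w (r + N + r + 1))) := by
  have hk := sum_qBinom_mul_qPoch_neg q r N
  have hneg : ∀ t, qPoch (-q) q (r + t) = qPoch (-q) q r * qPoch (-q ^ (r + 1)) q t := fun t => by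
    rw [qPoch_add]; congr 2; ring
  rw [hneg N, ← hk]
  simp only [mul_sum, sum_mul]
  refine sum_congr rfl fun t ht => ?_
  obtain ⟨u, rfl⟩ := Nat.exists_eq_add_of_le (Nat.lt_succ_iff.1 (mem_range.1 ht))
  rw [show t + u - t = u by omega, hneg t]
  have h1 := qBinom_eq hw (r + t) u
  have h2 := qBinom_eq hw t u
  have h3 : qPoch q q (r + (t + u) + r + 1) =
      qPoch q q (r + t + r + 1) * qPoch (q ^ (2 * r + 2 + t)) q u := by
    rw [show r + (t + u) + r + 1 = (r + t + r + 1) + u by ring, qPoch_add]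
    congr 2
    ring
  have h4 : w (r + t + r + 1) = w (r + (t + u) + r + 1) * qPoch (q ^ (2 * r + 2 + t)) q u := by
    linear_combination (-w (r + t + r + 1)) * hw (r + (t + u) + r + 1) +
      w (r + t + r + 1) * w (r + (t + u) + r + 1) * h3 +
      w (r + (t + u) + r + 1) * qPoch (q ^ (2 * r + 2 + t)) q u * hw (r + t + r + 1)
  have h5 : w t * w u = qBinom q (t + u) t * w (t + u) := by
    linear_combination (-w (t + u)) * h2 - w t * w u * hw (t + u)
  have h6 : q ^ (r + t + 1).choose 2 = q ^ (r + 1).choose 2 * q ^ ((t + 1).choose 2 + r * t) := by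
    rw [← pow_add]; congr 1
    rw [choose_succ_two, choose_succ_two, choose_succ_two, choose_add_two]
    ring
  rw [← add_assoc] at *
  rw [h1, h4, h6]
  set M := qPoch (-q ^ (r + 1)) q t * qPoch (-q) q r * (w (r + t + u + r + 1) *
    qPoch (q ^ (2 * r + 2 + t)) q u) * (q ^ (r + 1).choose 2 * q ^ ((t + 1).choose 2 + r * t))
  linear_combination (M * qPoch q q (r + t + u) * w u * w t) * hw (r + t) +
    M * qPoch q q (r + t + u) * h5

/-- The Bailey chain started from the unit Bailey pair. -/
theorem chain_eq [IsDomain R] {q : R} (hq : q ≠ 0) {w : ℕ → R}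
    (hw : ∀ n, qPoch q q n * w n = 1) (j n : ℕ) :
    chain q j n = qPoch q q n * qPoch (-q) q n *
      ∑ r ∈ range (n + 1), thetaCoeff q (q ^ j) r * (w (n - r) * w (n + r + 1)) := by
  induction j generalizing n with
  | zero =>
    have h := qPoch_mul_sum_thetaCoeff hq one_ne_zero (mul_one q) hw n
    rw [pow_zero]
    have h' : ∑ r ∈ range (n + 1), thetaCoeff q 1 r * (w (n - r) * w (n + r + 1)) =
        w (2 * n + 1) * (qPoch q q (n + 1) * qPoch 1 q n) := by
      rw [← h]
      linear_combination (-∑ r ∈ range (n + 1), thetaCoeff q 1 r * (w (n - r) * w (n + r + 1))) *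
        hw (2 * n + 1)
    rw [h', chain]
    cases n with
    | zero =>
      have := hw 1
      simp only [qPoch_zero, zero_add, mul_zero, if_true]
      linear_combination -this
    | succ n =>
      have : qPoch 1 q (n + 1) = 0 := by
        rw [qPoch, prod_range_succ']; simp
      rw [this]
      simp
  | succ j ih =>
    rw [chain]
    simp only [ih, mul_sum]
    rw [sum_comm' (t' := range (n + 1)) (s' := fun r => Ico r (n + 1))
      (by intro x y; simp only [mem_range, mem_Ico]; omega)]
    refine sum_congr rfl fun r hr => ?_
    obtain ⟨N, rfl⟩ := Nat.exists_eq_add_of_le (Nat.lt_succ_iff.1 (mem_range.1 hr))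
    have hb := bailey_step hw r N
    have ht : thetaCoeff q (q ^ (j + 1)) r =
        thetaCoeff q (q ^ j) r * q ^ (r + 1).choose 2 := by
      simp only [thetaCoeff]
      ring
    rw [sum_Ico_eq_sum_range, show r + N + 1 - r = N + 1 by omega, ht,
      show r + N - r = N by omega]
    transitivity thetaCoeff q (q ^ j) r * (q ^ (r + 1).choose 2 *
      (qPoch q q (r + N) * qPoch (-q) q (r + N) * (w N * w (r + N + r + 1))))
    · rw [← hb, mul_sum]
      refine sum_congr rfl fun t _ => ?_
      rw [show r + t - r = t by omega]
      ring
    · ring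

/-- The generating function of the sequences `a₀, …, a_{l-1}` of natural numbers with
`a₀ < B` and `a₀/(t+1) ≥ a₁/(t+2) ≥ ⋯`. -/
def tailGF (q : R) : ℕ → ℕ → ℕ → R
  | 0, _, _ => 1
  | _ + 1, _, 0 => 0
  | l + 1, t, b + 1 => tailGF q (l + 1) t b + q ^ b * tailGF q l (t + 1) (b + b / (t + 1) + 1)

lemma tailGF_zero (q : R) (t B : ℕ) : tailGF q 0 t B = 1 := by
  rw [tailGF]

lemma tailGF_succ_zero (q : R) (l t : ℕ) : tailGF q (l + 1) t 0 = 0 := by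
  rw [tailGF]

lemma tailGF_succ_succ (q : R) (l t b : ℕ) : tailGF q (l + 1) t (b + 1) =
    tailGF q (l + 1) t b + q ^ b * tailGF q l (t + 1) (b + b / (t + 1) + 1) := by
  rw [tailGF]

lemma tailGF_level (q : R) (μ l t ρ : ℕ) (h : ρ ≤ t) :
    q ^ (μ * (t + 1).choose 2) * tailGF q l t ((t + 1) * μ + ρ + 1) =
      ∑ u ∈ range (l + 1), qBinom q (ρ + u) ρ *
        (q ^ (μ * (t + u + 1).choose 2) * tailGF q (l - u) (t + u) ((t + u + 1) * μ)) := by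
  induction l generalizing t ρ with
  | zero => simp [tailGF_zero, qBinom_self]
  | succ l ih =>
    have hdiv (ρ : ℕ) (h : ρ ≤ t) : ((t + 1) * μ + ρ) / (t + 1) = μ := by
      rw [Nat.mul_add_div (by omega), Nat.div_eq_of_lt (by omega), add_zero]
    have hstep (ρ : ℕ) (h : ρ ≤ t) :
        q ^ (μ * (t + 1).choose 2) * (q ^ ((t + 1) * μ + ρ) *
          tailGF q l (t + 1) ((t + 1) * μ + ρ + μ + 1)) =
        ∑ u ∈ range (l + 1), q ^ ρ * qBinom q (ρ + u) ρ *
          (q ^ (μ * (t + (u + 1) + 1).choose 2) *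
            tailGF q (l + 1 - (u + 1)) (t + (u + 1)) ((t + (u + 1) + 1) * μ)) := by
      have := ih (t + 1) ρ (by omega)
      rw [choose_succ_two (t + 1)] at this
      rw [show (t + 1) * μ + ρ + μ + 1 = (t + 1 + 1) * μ + ρ + 1 by ring]
      transitivity q ^ ρ * (q ^ (μ * ((t + 1).choose 2 + (t + 1))) *
        tailGF q l (t + 1) ((t + 1 + 1) * μ + ρ + 1))
      · ring
      · rw [this, mul_sum]
        refine sum_congr rfl fun u _ => ?_
        rw [show t + 1 + u = t + (u + 1) by ring, show l + 1 - (u + 1) = l - u by omega]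
        ring
    induction ρ with
    | zero =>
      have hs := hstep 0 h
      simp only [add_zero] at hs ⊢
      rw [tailGF_succ_succ, Nat.mul_div_cancel_left μ t.succ_pos, mul_add, hs,
        sum_range_succ' _ (l + 1), add_comm]
      simp [qBinom_zero_right]
    | succ ρ ihρ =>
      rw [tailGF_succ_succ, hdiv (ρ + 1) h, mul_add, hstep (ρ + 1) h, ← add_assoc,
        ihρ (by omega),
        sum_range_succ', sum_range_succ' _ (l + 1)]
      simp only [add_zero, qBinom_self]
      rw [add_right_comm, ← sum_add_distrib]
      congr 1
      refine sum_congr rfl fun u _ => ?_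
      rw [show ρ + 1 + (u + 1) = (ρ + (u + 1)) + 1 by ring, qBinom_succ_succ,
        show ρ + (u + 1) = ρ + 1 + u by ring]
      ring

/-- The generating function of the anti-lecture hall compositions of length `n` with first entry
at most `K` is an entry of the Bailey chain. -/
theorem tailGF_eq_chain (q : R) (n K : ℕ) : tailGF q n 0 K = chain q K n := by
  let v (μ t : ℕ) : R := q ^ (μ * (t + 1).choose 2) * tailGF q (n - t) t ((t + 1) * μ)
  have hv (μ t : ℕ) (ht : t ≤ n) : v (μ + 1) t =
      q ^ (t + 1).choose 2 * ∑ s ∈ range (n + 1), qBinom q s t * v μ s := by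
    have h := tailGF_level q μ (n - t) t t le_rfl
    obtain ⟨l, rfl⟩ := Nat.exists_eq_add_of_le ht
    rw [show t + l - t = l by omega] at h
    rw [show t + l + 1 = t + (l + 1) by ring, sum_range_add, sum_eq_zero, zero_add]
    · transitivity q ^ (t + 1).choose 2 * (q ^ (μ * (t + 1).choose 2) *
        tailGF q l t ((t + 1) * μ + t + 1))
      · simp only [v]
        rw [show t + l - t = l by omega, show (t + 1) * (μ + 1) = (t + 1) * μ + t + 1 by ring]
        ring
      · rw [h]
        congr 1
        refine sum_congr rfl fun u _ => ?_
        simp only [v]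
        rw [show t + l - (t + u) = l - u by omega]
    · intro s hs
      rw [qBinom_eq_zero_of_lt q (mem_range.1 hs), zero_mul]
  have hmove (μ j : ℕ) : ∑ t ∈ range (n + 1), v (μ + 1) t * chain q j t =
      ∑ s ∈ range (n + 1), v μ s * chain q (j + 1) s := by
    have hs (s : ℕ) (hs : s ∈ range (n + 1)) : v μ s * chain q (j + 1) s =
        ∑ t ∈ range (n + 1), v μ s * (q ^ (t + 1).choose 2 * (qBinom q s t * chain q j t)) := by
      rw [chain, mul_sum]
      refine sum_subset (range_mono (by simpa using hs)) fun t _ ht => ?_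
      rw [qBinom_eq_zero_of_lt q (by simpa using ht)]
      ring
    rw [sum_congr rfl hs, sum_comm]
    refine sum_congr rfl fun t ht => ?_
    rw [hv μ t (Nat.lt_succ_iff.1 (mem_range.1 ht)), mul_sum, sum_mul]
    exact sum_congr rfl fun _ _ => by ring
  have hiter (μ j : ℕ) : ∑ t ∈ range (n + 1), v μ t * chain q j t =
      ∑ t ∈ range (n + 1), v 0 t * chain q (μ + j) t := by
    induction μ generalizing j with
    | zero => rw [zero_add]
    | succ μ ih => rw [hmove, ih, show μ + (j + 1) = μ + 1 + j by ring]
  have h := hiter K 0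
  rw [sum_range_succ', sum_range_succ, sum_eq_zero, sum_eq_zero] at h
  · simpa [v, chain, tailGF_zero] using h
  · intro t ht
    obtain ⟨l, hl⟩ := Nat.exists_eq_add_of_lt (mem_range.1 ht)
    simp only [v]
    rw [show n - t = l + 1 by omega, mul_zero, tailGF_succ_zero]
    ring
  · intro t _
    simp [chain]

end QSeries

section Counting

open PowerSeries

/-- Sequences of length `l` counted by `tailGF _ l t B`, of weight `d`. -/
def tailSet (l t B d : ℕ) : Set (ℕ → ℕ) :=
  {f | (∀ j, l ≤ j → f j = 0) ∧ (0 < l → f 0 < B) ∧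
    (∀ j, (t + 1 + j) * f (j + 1) ≤ (t + 2 + j) * f j) ∧ ∑ j ∈ range l, f j = d}

/-- Prepend an entry to a sequence. -/
def cons (b : ℕ) (f : ℕ → ℕ) : ℕ → ℕ
  | 0 => b
  | j + 1 => f j

lemma cons_injective (b : ℕ) : Function.Injective (cons b) :=
  fun _ _ h => funext fun j => congrFun h (j + 1)

lemma tailSet_succ_succ (l t b d : ℕ) : tailSet (l + 1) t (b + 1) d =
    tailSet (l + 1) t b d ∪
      if b ≤ d then cons b '' tailSet l (t + 1) (b + b / (t + 1) + 1) (d - b) else ∅ := by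
  have hb (y : ℕ) : (t + 1) * y ≤ (t + 2) * b ↔ y < b + b / (t + 1) + 1 := by
    rw [Nat.lt_succ_iff, add_comm b, ← Nat.add_mul_div_left b b t.succ_pos,
      Nat.le_div_iff_mul_le t.succ_pos, mul_comm y,
      show b + t.succ * b = (t + 2) * b by rw [Nat.succ_eq_add_one]; ring]
  ext f
  constructor
  · rintro ⟨h0, h1, h2, h3⟩
    rcases Nat.lt_succ_iff_lt_or_eq.1 (h1 l.succ_pos) with h | h
    · exact Or.inl ⟨h0, fun _ => h, h2, h3⟩
    · right
      rw [sum_range_succ', h] at h3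
      rw [if_pos (by omega)]
      refine ⟨fun j => f (j + 1), ⟨fun j hj => h0 _ (by omega), fun _ => ?_, fun j => ?_,
        Nat.eq_sub_of_add_eq h3⟩, ?_⟩
      · rw [← hb]
        simpa [h] using h2 0
      · have := h2 (j + 1)
        rwa [show t + 1 + (j + 1) = t + 1 + 1 + j by ring,
          show t + 2 + (j + 1) = t + 1 + 2 + j by ring] at this
      · funext j
        cases j with
        | zero => exact h.symm
        | succ j => rfl
  · rintro (⟨h0, h1, h2, h3⟩ | h)
    · exact ⟨h0, fun h => (h1 h).trans (Nat.lt_succ_self b), h2, h3⟩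
    · split_ifs at h with hbd
      · obtain ⟨g, ⟨h0, h1, h2, h3⟩, rfl⟩ := h
        refine ⟨fun j hj => ?_, fun _ => Nat.lt_succ_self b, fun j => ?_, ?_⟩
        · cases j with
          | zero => omega
          | succ j => exact h0 j (by omega)
        · cases j with
          | zero =>
            change (t + 1) * g 0 ≤ (t + 2) * b
            rcases Nat.eq_zero_or_pos l with rfl | hl
            · simp [h0 0 le_rfl]
            · exact (hb _).2 (h1 hl)
          | succ j =>
            have := h2 j
            rwa [show t + 1 + 1 + j = t + 1 + (j + 1) by ring,
              show t + 1 + 2 + j = t + 2 + (j + 1) by ring] at this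
        · rw [sum_range_succ']
          change ∑ j ∈ range l, g j + b = d
          omega
      · exact h.elim

lemma tailSet_ncard (l t B d : ℕ) : (tailSet l t B d).Finite ∧
    ((tailSet l t B d).ncard : ℤ) = coeff d (tailGF (X : ℤ⟦X⟧) l t B) := by
  induction l generalizing t B d with
  | zero =>
    have h : tailSet 0 t B d = if d = 0 then {0} else ∅ := by
      ext f
      simp only [tailSet, zero_le, forall_const, lt_irrefl, false_imp_iff, true_and, range_zero,
        sum_empty, Set.mem_ofPred_eq]
      split_ifs with hd
      · constructor
        · exact fun h => funext h.1
        · rintro rfl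
          simp [hd]
      · simp only [Set.mem_empty_iff_false, iff_false]
        exact fun h => hd h.2.2.symm
    rw [h, tailGF_zero, coeff_one]
    split_ifs <;> simp
  | succ l ih =>
    induction B with
    | zero =>
      have h : tailSet (l + 1) t 0 d = ∅ :=
        Set.eq_empty_of_forall_notMem fun f hf => absurd (hf.2.1 l.succ_pos) (Nat.not_lt_zero _)
      simp [h, tailGF_succ_zero]
    | succ b ihb =>
      have hfin : (if b ≤ d then cons b '' tailSet l (t + 1) (b + b / (t + 1) + 1) (d - b)
          else ∅).Finite := by
        split_ifs
        · exact (ih _ _ _).1.image _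
        · exact Set.finite_empty
      have hdisj : Disjoint (tailSet (l + 1) t b d)
          (if b ≤ d then cons b '' tailSet l (t + 1) (b + b / (t + 1) + 1) (d - b) else ∅) := by
        rw [Set.disjoint_left]
        rintro f ⟨-, h, -⟩ hf
        split_ifs at hf
        · obtain ⟨g, -, rfl⟩ := hf
          exact lt_irrefl _ (h l.succ_pos)
        · exact hf
      rw [tailSet_succ_succ]
      refine ⟨ihb.1.union hfin, ?_⟩
      rw [Set.ncard_union_eq hdisj ihb.1 hfin, tailGF_succ_succ, map_add, Nat.cast_add, ihb.2,
        coeff_X_pow_mul']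
      congr 1
      split_ifs
      · rw [Set.ncard_image_of_injective _ (cons_injective b), (ih _ _ _).2]
      · simp

lemma Fset_eq_tailSet {k n l : ℕ} (hl : 0 < l) (hn : n ≤ l) :
    Fset k n = tailSet l 0 (k + 1) n := by
  ext f
  constructor
  · rintro ⟨⟨hfin, hr⟩, hk, hw⟩
    obtain ⟨N, hN⟩ := hfin.bddAbove
    have hsupp : Function.support f ⊆ range (N + 1) := fun j hj => by
      have := hN hj
      simp only [coe_range, Set.mem_Iio]
      omega
    rw [wt, finsum_eq_sum_of_support_subset f hsupp] at hw
    have hpos (j : ℕ) (hj : f j ≠ 0) (i : ℕ) (hi : i ≤ j) : 1 ≤ f i := by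
      induction j with
      | zero =>
        obtain rfl : i = 0 := by omega
        omega
      | succ j ih =>
        rcases hi.eq_or_lt with rfl | hi
        · omega
        · refine ih (fun h => ?_) (by omega)
          have := hr j
          rw [h, mul_zero, Nat.le_zero, mul_eq_zero] at this
          omega
    have hzero (j : ℕ) (hj : l ≤ j) : f j = 0 := by
      by_contra h
      have hjN := hN h
      have h1 : ∑ i ∈ range (j + 1), 1 ≤ ∑ i ∈ range (j + 1), f i :=
        sum_le_sum fun i hi => hpos j h i (Nat.lt_succ_iff.1 (mem_range.1 hi))
      have h2 : ∑ i ∈ range (j + 1), f i ≤ ∑ i ∈ range (N + 1), f i :=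
        sum_le_sum_of_subset (range_mono (by omega))
      simp only [sum_const, card_range, smul_eq_mul, mul_one] at h1
      omega
    refine ⟨hzero, fun _ => Nat.lt_succ_iff.2 hk, fun j => ?_, ?_⟩
    · have := hr j
      rwa [show 0 + 1 + j = j + 1 by ring, show 0 + 2 + j = j + 2 by ring]
    · rw [← hw, ← finsum_eq_sum_of_support_subset f hsupp]
      refine (finsum_eq_sum_of_support_subset f fun j hj => ?_).symm
      by_contra h
      exact hj (hzero j (by simpa using h))
  · rintro ⟨h0, h1, h2, h3⟩
    have hsupp : Function.support f ⊆ range l := fun j hj => by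
      by_contra h
      exact hj (h0 j (by simpa using h))
    refine ⟨⟨(range l).finite_toSet.subset hsupp, fun j => ?_⟩, Nat.lt_succ_iff.1 (h1 hl), ?_⟩
    · have := h2 j
      rwa [show 0 + 1 + j = j + 1 by ring, show 0 + 2 + j = j + 2 by ring] at this
    · rw [wt, finsum_eq_sum_of_support_subset f hsupp, h3]

theorem Fset_ncard {k n l : ℕ} (hl : 0 < l) (hn : n ≤ l) :
    ((Fset k n).ncard : ℤ) = coeff n (chain (X : ℤ⟦X⟧) (k + 1) l) := by
  rw [Fset_eq_tailSet hl hn, (tailSet_ncard _ _ _ _).2, tailGF_eq_chain]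

lemma Hset_ncard (p : ℕ → Prop) [DecidablePred p] (n : ℕ) :
    ({x : Multiset ℕ × Multiset ℕ | x.1.Nodup ∧ (∀ i ∈ x.1, 0 < i) ∧ (∀ i ∈ x.2, 0 < i ∧ p i) ∧
      x.1.sum + x.2.sum = n}.ncard : ℤ) =
    coeff n (PowerSeries.mk (fun i => (#(Nat.Partition.countRestricted i 2) : ℤ)) *
      PowerSeries.mk (fun i => (#(Nat.Partition.restricted i p) : ℤ))) := by
  let T : Finset (Σ ij : ℕ × ℕ, ij.1.Partition × ij.2.Partition) :=
    (antidiagonal n).sigma fun ij =>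
      Nat.Partition.countRestricted ij.1 2 ×ˢ Nat.Partition.restricted ij.2 p
  let g (x : Σ ij : ℕ × ℕ, ij.1.Partition × ij.2.Partition) : Multiset ℕ × Multiset ℕ :=
    (x.2.1.parts, x.2.2.parts)
  have hg : Function.Injective g := by
    rintro ⟨⟨i, j⟩, ⟨a, ha, hi⟩, ⟨b, hb, hj⟩⟩ ⟨⟨i', j'⟩, ⟨a', ha', hi'⟩, ⟨b', hb', hj'⟩⟩ h
    obtain ⟨h1, h2⟩ := Prod.ext_iff.1 h
    change a = a' at h1
    change b = b' at h2
    dsimp only at hi hj hi' hj'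
    subst h1 h2 hi hj hi' hj'
    rfl
  have himage : {x : Multiset ℕ × Multiset ℕ | x.1.Nodup ∧ (∀ i ∈ x.1, 0 < i) ∧
      (∀ i ∈ x.2, 0 < i ∧ p i) ∧ x.1.sum + x.2.sum = n} = g '' T := by
    ext ⟨a, b⟩
    constructor
    · rintro ⟨h1, h2, h3, h4⟩
      refine ⟨⟨(a.sum, b.sum), ⟨a, fun hi => h2 _ hi, rfl⟩, ⟨b, fun hi => (h3 _ hi).1, rfl⟩⟩,
        ?_, rfl⟩
      simp only [T, mem_coe, mem_sigma, HasAntidiagonal.mem_antidiagonal, mem_product,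
        Nat.Partition.countRestricted_two]
      refine ⟨h4, ?_, ?_⟩
      · simpa [Nat.Partition.distincts] using h1
      · simpa [Nat.Partition.restricted] using fun i hi => (h3 i hi).2
    · rintro ⟨⟨⟨i, j⟩, ⟨a, ha, hi⟩, ⟨b, hb, hj⟩⟩, hT, h⟩
      obtain ⟨rfl, rfl⟩ := Prod.ext_iff.1 h
      simp only [T, mem_coe, mem_sigma, HasAntidiagonal.mem_antidiagonal, mem_product,
        Nat.Partition.countRestricted_two] at hT
      obtain ⟨h1, h2, h3⟩ := hT
      simp only [Nat.Partition.distincts, mem_filter_univ] at h2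
      simp only [Nat.Partition.restricted, mem_filter_univ] at h3
      dsimp only at hi hj
      subst hi hj
      exact ⟨h2, fun i hi => ha hi, fun i hi => ⟨hb hi, h3 i hi⟩, h1⟩
  rw [himage, Set.ncard_image_of_injective _ hg, Set.ncard_coe_finset, card_sigma, coeff_mul]
  simp [card_product]

end Counting

section Truncation

variable {R S : Type*} [CommRing R] [CommRing S]

lemma map_qPoch (φ : R →+* S) (a q : R) (n : ℕ) :
    φ (qPoch a q n) = qPoch (φ a) (φ q) n := by
  simp [qPoch]

lemma map_thetaCoeff (φ : R →+* S) (x y : R) (r : ℕ) :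
    φ (thetaCoeff x y r) = thetaCoeff (φ x) (φ y) r := by
  simp [thetaCoeff]

lemma qPoch_eq_of_pow_eq_zero {q : R} {D n : ℕ} (hq : q ^ D = 0) (hn : D ≤ n) (a : R) :
    qPoch a q n = qPoch a q D := by
  obtain ⟨l, rfl⟩ := Nat.exists_eq_add_of_le hn
  rw [qPoch_add, hq]
  simp [qPoch]

lemma thetaCoeff_eq_zero {x y : R} {D r : ℕ} (hy : y ^ D = 0) (hr : D ≤ r) :
    thetaCoeff x y r = 0 := by
  rw [thetaCoeff, pow_eq_zero_of_le (by rw [choose_succ_two]; omega) hy]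
  ring

lemma sum_thetaCoeff_mul_eq {x y q : R} {D N : ℕ} (hy : y ^ D = 0) (hq : q ^ D = 0)
    {w : ℕ → R} (hw : ∀ n, qPoch q q n * w n = 1) (hN : 2 * D ≤ N) :
    ∑ r ∈ range (N + 1), thetaCoeff x y r * (w (N - r) * w (N + r + 1)) =
      (∑ r ∈ range (N + 1), thetaCoeff x y r) * (w D * w D) := by
  have hwD (n : ℕ) (hn : D ≤ n) : w n = w D := by
    have h := hw n
    rw [qPoch_eq_of_pow_eq_zero hq hn] at h
    linear_combination (-w n) * hw D + w D * h
  rw [sum_mul]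
  refine sum_congr rfl fun r _ => ?_
  rcases le_total D r with hr | hr
  · rw [thetaCoeff_eq_zero hy hr]
    ring
  · rw [hwD _ (by omega), hwD (N + r + 1) (by omega)]

end Truncation

section Product

open PowerSeries

lemma exists_qPoch_inverse (a : ℕ) :
    ∃ w : ℕ → ℤ⟦X⟧, ∀ n, qPoch (X ^ (a + 1)) (X ^ (a + 1)) n * w n = 1 := by
  have h (n : ℕ) : IsUnit (qPoch (X ^ (a + 1) : ℤ⟦X⟧) (X ^ (a + 1)) n) := by
    rw [isUnit_iff_constantCoeff, map_qPoch]
    simp [qPoch]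
  choose w hw using fun n => (h n).exists_right_inv
  exact ⟨w, hw⟩

theorem map_chain_mul {S : Type*} [CommRing S] (φ : ℤ⟦X⟧ →+* S) {D N : ℕ}
    (hφ : φ X ^ D = 0) (hN : 2 * D ≤ N) (k : ℕ) :
    φ (chain X (k + 2) N * qPoch X X D) =
      φ (qPoch (-X) X D * (qPoch X (X ^ (k + 3)) D * qPoch (X ^ (k + 2)) (X ^ (k + 3)) D *
        qPoch (X ^ (k + 3)) (X ^ (k + 3)) D)) := by
  obtain ⟨w, hw⟩ := exists_qPoch_inverse 0
  obtain ⟨W, hW⟩ := exists_qPoch_inverse (k + 2)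
  simp only [zero_add, pow_one] at hw
  have hX : (X : ℤ⟦X⟧) ≠ 0 := X_ne_zero
  have h1 := congrArg φ (chain_eq hX hw (k + 2) N)
  have h2 := congrArg φ (qPoch_mul_sum_thetaCoeff hX (pow_ne_zero (k + 2) hX)
    (pow_succ' X (k + 2)).symm hW N)
  replace hw (n : ℕ) := congrArg φ (hw n)
  replace hW (n : ℕ) := congrArg φ (hW n)
  have hpow (a : ℕ) : (φ X ^ (a + 1)) ^ D = 0 := by
    rw [← pow_mul, mul_comm, pow_mul, hφ, zero_pow a.succ_ne_zero]
  simp only [map_mul, map_sum, map_qPoch, map_thetaCoeff, map_pow, map_neg, map_one] at *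
  rw [sum_thetaCoeff_mul_eq (w := fun n => φ (w n)) (hpow (k + 1)) hφ hw hN,
    qPoch_eq_of_pow_eq_zero hφ (show D ≤ N by omega),
    qPoch_eq_of_pow_eq_zero hφ (show D ≤ N by omega)] at h1
  rw [sum_thetaCoeff_mul_eq (w := fun n => φ (W n)) (hpow (k + 1)) (hpow (k + 2)) hW hN,
    qPoch_eq_of_pow_eq_zero (hpow (k + 2)) (show D ≤ 2 * N + 1 by omega),
    qPoch_eq_of_pow_eq_zero (hpow (k + 2)) (show D ≤ N + 1 by omega),
    qPoch_eq_of_pow_eq_zero (hpow (k + 2)) (show D ≤ N by omega)] at h2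
  have hwD := hw D
  have hWD := hW D
  set x := φ X
  set T := ∑ r ∈ range (N + 1), thetaCoeff x (x ^ (k + 2)) r
  set Q := x ^ (k + 3)
  have hT : T = qPoch Q Q D * (qPoch x Q D * qPoch (x ^ (k + 2)) Q D) := by
    rw [← h2]
    linear_combination (-T) * (1 + qPoch Q Q D * φ (W D)) * hWD
  rw [h1]
  linear_combination qPoch (-x) x D * T * (1 + qPoch x x D * φ (w D)) * hwD +
    qPoch (-x) x D * hT

/-- Splitting `(X; X)_{mn}` by residues modulo `m = k + 3`. -/
lemma qPoch_eq_prod_mul (k n : ℕ) :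
    qPoch (X : ℤ⟦X⟧) X ((k + 3) * n) =
      (∏ i ∈ range ((k + 3) * n), if (i + 1) % (k + 3) ≠ 0 ∧ (i + 1) % (k + 3) ≠ 1 ∧
        (i + 1) % (k + 3) ≠ k + 3 - 1 then 1 - (X : ℤ⟦X⟧) ^ (i + 1) else 1) *
      (qPoch X (X ^ (k + 3)) n * qPoch (X ^ (k + 2)) (X ^ (k + 3)) n *
        qPoch (X ^ (k + 3)) (X ^ (k + 3)) n) := by
  induction n with
  | zero => simp [qPoch_zero]
  | succ n ih =>
    have hsplit (u : ℕ → ℤ⟦X⟧) : ∏ i ∈ range (k + 3), u i =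
        (∏ i ∈ range k, u (i + 1)) * (u 0 * u (k + 1) * u (k + 2)) := by
      rw [prod_range_succ, prod_range_succ, prod_range_succ']
      ring
    have hmod (i j : ℕ) (hj : i + 1 = j) (h : j < k + 3) :
        ((k + 3) * n + i + 1) % (k + 3) = j := by
      rw [add_assoc, Nat.mul_add_mod, hj, Nat.mod_eq_of_lt h]
    have h0 : ((k + 3) * n + (k + 2) + 1) % (k + 3) = 0 := by
      rw [show (k + 3) * n + (k + 2) + 1 = (k + 3) * (n + 1) by ring, Nat.mul_mod_right]
    have hblock : qPoch (X * X ^ ((k + 3) * n) : ℤ⟦X⟧) X (k + 3) =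
        (∏ i ∈ range k, (1 - X * X ^ ((k + 3) * n) * X ^ (i + 1))) *
          ((1 - X * X ^ ((k + 3) * n) * X ^ 0) * (1 - X * X ^ ((k + 3) * n) * X ^ (k + 1)) *
            (1 - X * X ^ ((k + 3) * n) * X ^ (k + 2))) := hsplit _
    rw [mul_add_one, qPoch_add, prod_range_add, ih, hblock, hsplit, qPoch_succ X (X ^ (k + 3)) n,
      qPoch_succ (X ^ (k + 2)) (X ^ (k + 3)) n, qPoch_succ (X ^ (k + 3)) (X ^ (k + 3)) n]
    rw [hmod 0 1 rfl (by omega), hmod (k + 1) (k + 2) rfl (by omega), h0]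
    have hprod : (∏ i ∈ range k, if ((k + 3) * n + (i + 1) + 1) % (k + 3) ≠ 0 ∧
        ((k + 3) * n + (i + 1) + 1) % (k + 3) ≠ 1 ∧
        ((k + 3) * n + (i + 1) + 1) % (k + 3) ≠ k + 3 - 1 then
          1 - (X : ℤ⟦X⟧) ^ ((k + 3) * n + (i + 1) + 1) else 1) =
        ∏ i ∈ range k, (1 - X * X ^ ((k + 3) * n) * X ^ (i + 1)) := by
      refine prod_congr rfl fun i hi => ?_
      have hi := mem_range.1 hi
      rw [hmod (i + 1) (i + 2) rfl (by omega), if_pos (by omega)]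
      ring
    rw [hprod, if_neg (by simp), if_neg (by simp), if_neg (by simp)]
    ring

open PowerSeries.WithPiTopology in
/-- The generating function of overpartitions with non-overlined parts satisfying `p`,
truncated. -/
lemma eventually_overpartition_mul (p : ℕ → Prop) [DecidablePred p] (D : ℕ) :
    ∀ᶠ M in Filter.atTop, (X : ℤ⟦X⟧) ^ D ∣
      PowerSeries.mk (fun i => (#(Nat.Partition.countRestricted i 2) : ℤ)) *
        PowerSeries.mk (fun i => (#(Nat.Partition.restricted i p) : ℤ)) *
        (∏ i ∈ range M, if p (i + 1) then 1 - (X : ℤ⟦X⟧) ^ (i + 1) else 1) -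
      qPoch (-X) X M := by
  have hprod := (Nat.Partition.hasProd_powerSeriesMk_card_countRestricted ℤ two_pos).mul
    (Nat.Partition.hasProd_powerSeriesMk_card_restricted ℤ p)
  have hlim := hprod.tendsto_prod_nat
  rw [tendsto_iff_coeff_tendsto] at hlim
  have hev : ∀ᶠ M in Filter.atTop, ∀ d ∈ range D, _ :=
    (Filter.eventually_all_finset (range D)).2 fun d _ =>
      (nhds_discrete ℤ ▸ hlim d).eventually (Filter.mem_pure.2 rfl)
  filter_upwards [hev] with M hM
  have hcancel : (∏ i ∈ range M, (∑ j ∈ range 2, (X : ℤ⟦X⟧) ^ ((i + 1) * j)) *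
        if p (i + 1) then ∑' j : ℕ, (X : ℤ⟦X⟧) ^ ((i + 1) * j) else 1) *
      (∏ i ∈ range M, if p (i + 1) then 1 - (X : ℤ⟦X⟧) ^ (i + 1) else 1) = qPoch (-X) X M := by
    rw [← prod_mul_distrib, qPoch]
    refine prod_congr rfl fun i _ => ?_
    have h2 : ∑ j ∈ range 2, (X : ℤ⟦X⟧) ^ ((i + 1) * j) = 1 - -X * X ^ i := by
      rw [sum_range_succ, sum_range_one]
      ring
    rw [h2]
    split_ifs
    · simp_rw [pow_mul]
      rw [mul_assoc, tsum_pow_mul_one_sub_of_constantCoeff_eq_zero (by simp), mul_one]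
    · ring
  rw [← hcancel, ← sub_mul]
  refine Dvd.dvd.mul_right (X_pow_dvd_iff.2 fun d hd => ?_) _
  rw [map_sub, sub_eq_zero]
  exact hM d (mem_range.2 hd)

theorem Fset_ncard_eq_Hset_ncard (k n : ℕ) (hn : 0 < n) :
    (Fset (k + 1) n).ncard = (Hset (k + 3) n).ncard := by
  let p (i : ℕ) : Prop := i % (k + 3) ≠ 0 ∧ i % (k + 3) ≠ 1 ∧ i % (k + 3) ≠ k + 3 - 1
  have hF := Fset_ncard (k := k + 1) (l := 2 * (n + 1)) (by omega) (show n ≤ _ by omega)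
  have hH := Hset_ncard p n
  set G := PowerSeries.mk (fun i => (#(Nat.Partition.countRestricted i 2) : ℤ)) *
    PowerSeries.mk (fun i => (#(Nat.Partition.restricted i p) : ℤ)) with hG
  let φ := Ideal.Quotient.mk (Ideal.span {(X : ℤ⟦X⟧) ^ (n + 1)})
  have hdvd (a b : ℤ⟦X⟧) : φ a = φ b ↔ X ^ (n + 1) ∣ a - b := by
    rw [Ideal.Quotient.eq, Ideal.mem_span_singleton]
  have hφ : φ X ^ (n + 1) = 0 := by
    rw [← map_pow, ← map_zero φ, hdvd, sub_zero]
  have hpow (a : ℕ) : (φ X ^ (a + 1)) ^ (n + 1) = 0 := by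
    rw [← pow_mul, mul_comm, pow_mul, hφ, zero_pow a.succ_ne_zero]
  have hchain := map_chain_mul φ hφ le_rfl k
  obtain ⟨M, hM⟩ := Filter.eventually_atTop.1 (eventually_overpartition_mul p (n + 1))
  have hle : M + (n + 1) ≤ (k + 3) * (M + (n + 1)) := Nat.le_mul_of_pos_left _ (by omega)
  have hprod := (hdvd _ _).2 (hM ((k + 3) * (M + (n + 1))) (by omega))
  have hsplit := congrArg φ (qPoch_eq_prod_mul k (M + (n + 1)))
  obtain ⟨w, hw⟩ := exists_qPoch_inverse 0
  replace hw := congrArg φ (hw (n + 1))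
  rw [← hG] at hprod
  simp only [zero_add, pow_one] at hw
  have key : φ (chain X (k + 2) (2 * (n + 1))) = φ G := by
    simp only [map_mul, map_qPoch, map_pow, map_neg, map_one] at hchain hprod hsplit hw
    rw [qPoch_eq_of_pow_eq_zero hφ (show n + 1 ≤ (k + 3) * (M + (n + 1)) by omega)]
      at hprod hsplit
    rw [qPoch_eq_of_pow_eq_zero (hpow (k + 2)) (show n + 1 ≤ M + (n + 1) by omega),
      qPoch_eq_of_pow_eq_zero (hpow (k + 2)) (show n + 1 ≤ M + (n + 1) by omega),
      qPoch_eq_of_pow_eq_zero (hpow (k + 2)) (show n + 1 ≤ M + (n + 1) by omega)] at hsplit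
    rw [← hprod, mul_assoc, ← hsplit] at hchain
    linear_combination φ (w (n + 1)) * hchain -
      (φ (chain X (k + 2) (2 * (n + 1))) - φ G) * hw
  have hcoeff := X_pow_dvd_iff.1 ((hdvd _ _).1 key) n n.lt_succ_self
  rw [map_sub, ← hF, ← hH, sub_eq_zero] at hcoeff
  exact_mod_cast hcoeff

end Product

end AntiLectureHall

/-- For `k ≥ 2` and `n ≥ 1`, `|F_{2k-2}(n)| = |H_{2k}(n)|`. -/
theorem alh_eq_overpartitions_even (k n : ℕ) (hk : 2 ≤ k) (hn : 0 < n) :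
    (Fset (2 * k - 2) n).ncard = (Hset (2 * k) n).ncard := by
  have h := AntiLectureHall.Fset_ncard_eq_Hset_ncard (2 * k - 3) n hn
  rwa [show 2 * k - 3 + 1 = 2 * k - 2 by omega, show 2 * k - 3 + 3 = 2 * k by omega] at h
end
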